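/- arXiv:1304.3948 — 12 statements merged into one kernel-verified Lean document; each statement's English description precedes it below -/
import Mathlib

section
/- For every natural number n and every convex subset F of the Birkhoff polytope B_n that is an extreme subset of B_n (i.e. every face F of B_n), F equals the convex hull of the permutation matrices contained in it: F = convexHull ℝ {M | M ∈ F ∧ ∃ σ : Equiv.Perm (Fin n), M = M(σ)}. In particular, every face of B_n is the convex hull of the permutation matrices of some set Σ of permutations. -/
/-- The permutation matrix of `σ`: entry 1 at `(i, σ i)` and 0 elsewhere. -/
def permMat {n : ℕ} (σ : Equiv.Perm (Fin n)) : Matrix (Fin n) (Fin n) ℝ :=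
  fun i j => if σ i = j then 1 else 0

/-- A convex extreme subset of a convex hull is the convex hull of the generators it contains. -/
theorem IsExtreme.eq_convexHull_inter {E : Type*} [AddCommGroup E] [Module ℝ E] {S F : Set E}
    (hF : IsExtreme ℝ (convexHull ℝ S) F) (hconv : Convex ℝ F) :
    F = convexHull ℝ (F ∩ S) := by
  refine Set.Subset.antisymm (fun x hx => ?_) (convexHull_min Set.inter_subset_left hconv)
  have hout : convexHull ℝ (S \ F) ⊆ convexHull ℝ S \ F :=
    convexHull_min (fun y hy => ⟨subset_convexHull ℝ S hy.1, hy.2⟩)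
      (hF.convex_sdiff (convex_convexHull ℝ S))
  have hSF : F ∩ S ∪ S \ F = S := by rw [Set.inter_comm, Set.inter_union_sdiff]
  have hxS : x ∈ convexHull ℝ (F ∩ S ∪ S \ F) := hSF.symm ▸ hF.subset hx
  rcases (F ∩ S).eq_empty_or_nonempty with h | h
  · rw [h, Set.empty_union] at hxS
    exact absurd hx (hout hxS).2
  rcases (S \ F).eq_empty_or_nonempty with h' | h'
  · rwa [h', Set.union_empty] at hxS
  rw [convexHull_union h h', mem_convexJoin] at hxS
  obtain ⟨a, ha, b, hb, hab⟩ := hxS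
  have haS := convexHull_mono (𝕜 := ℝ) Set.inter_subset_right ha
  rw [← insert_endpoints_openSegment] at hab
  rcases hab with rfl | rfl | hab
  · exact ha
  · exact absurd hx (hout hb).2
  · exact absurd (hF.right_mem_of_mem_openSegment haS (hout hb).1 hx hab) (hout hb).2

theorem permMat_eq_permMatrix {n : ℕ} (σ : Equiv.Perm (Fin n)) :
    permMat σ = σ.permMatrix ℝ := by
  ext i j
  simp [permMat, Equiv.toPEquiv_apply]

/-- Every face (convex extreme subset) of the Birkhoff polytope `B_n` is the convex
hull of the permutation matrices contained in it. -/
theorem stmt0 (n : ℕ) (F : Set (Matrix (Fin n) (Fin n) ℝ))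
    (hconv : Convex ℝ F)
    (hext : IsExtreme ℝ (doublyStochastic ℝ (Fin n) : Set (Matrix (Fin n) (Fin n) ℝ)) F) :
    F = convexHull ℝ {M | M ∈ F ∧ ∃ σ : Equiv.Perm (Fin n), M = permMat σ} := by
  rw [doublyStochastic_eq_convexHull_permMatrix] at hext
  convert hext.eq_convexHull_inter hconv using 3
  simp only [permMat_eq_permMatrix, eq_comm]
  rfl
end

section
/- For every natural number n and every relation R : Fin n → Fin n → Prop, the set of extreme points of face(R) is exactly the set of permutation matrices of matchings of R: Set.extremePoints ℝ (face R) = {M(σ) | σ a matching of R}. (Vertices of the face correspond bijectively to perfect matchings of the bipartite graph of R.) -/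
/-- `σ` is a (perfect) matching of the bipartite graph of `R`. -/
def IsMatching {n : ℕ} (R : Fin n → Fin n → Prop) (σ : Equiv.Perm (Fin n)) : Prop :=
  ∀ i, R i (σ i)

/-- `R` is elementary (a face graph): every edge lies in some matching. -/
def IsElementary {n : ℕ} (R : Fin n → Fin n → Prop) : Prop :=
  ∀ i j, R i j → ∃ σ : Equiv.Perm (Fin n), IsMatching R σ ∧ σ i = j

/-- The face of the Birkhoff polytope corresponding to `R`. -/
def face {n : ℕ} (R : Fin n → Fin n → Prop) : Set (Matrix (Fin n) (Fin n) ℝ) :=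
  convexHull ℝ {M | ∃ σ : Equiv.Perm (Fin n), IsMatching R σ ∧ M = permMat σ}

/-- The bipartite simple graph `G_R` on `Fin n ⊕ Fin n`, where `Sum.inl i` and
`Sum.inr j` are adjacent iff `R i j`. -/
def graphOf {n : ℕ} (R : Fin n → Fin n → Prop) : SimpleGraph (Fin n ⊕ Fin n) :=
  SimpleGraph.fromRel (fun a b => ∃ i j, a = Sum.inl i ∧ b = Sum.inr j ∧ R i j)

/-- The degree of the upper node `i`. -/
def upDeg {n : ℕ} (R : Fin n → Fin n → Prop) [∀ i j, Decidable (R i j)] (i : Fin n) : ℕ :=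
  Fintype.card {j // R i j}

/-- The degree of the lower node `j`. -/
def loDeg {n : ℕ} (R : Fin n → Fin n → Prop) [∀ i j, Decidable (R i j)] (j : Fin n) : ℕ :=
  Fintype.card {i // R i j}

/-- The number of edges of the bipartite graph of `R`. -/
def edgeCount {n : ℕ} (R : Fin n → Fin n → Prop) [∀ i j, Decidable (R i j)] : ℕ :=
  Fintype.card {p : Fin n × Fin n // R p.1 p.2}

/-- An upper node `v` of degree 2 with neighbors `w₁ ≠ w₂` is reducible if no `u ≠ v`
is adjacent to both `w₁` and `w₂`. -/
def UpperReducible {n : ℕ} (R : Fin n → Fin n → Prop) (v : Fin n) : Prop :=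
  ∃ w₁ w₂ : Fin n, w₁ ≠ w₂ ∧ R v w₁ ∧ R v w₂ ∧ (∀ j, R v j → j = w₁ ∨ j = w₂) ∧
    ¬ ∃ u, u ≠ v ∧ R u w₁ ∧ R u w₂

/-- Reducibility of lower nodes, defined symmetrically. -/
def LowerReducible {n : ℕ} (R : Fin n → Fin n → Prop) (v : Fin n) : Prop :=
  UpperReducible (fun i j => R j i) v

/-- `R` is irreducible if none of its nodes is reducible. -/
def IrreducibleRel {n : ℕ} (R : Fin n → Fin n → Prop) : Prop :=
  (∀ v, ¬ UpperReducible R v) ∧ (∀ v, ¬ LowerReducible R v)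

/-- The face poset of a set `P`: the collection of its faces (convex extreme subsets),
ordered by inclusion. -/
def facesOf {E : Type*} [AddCommGroup E] [Module ℝ E] (P : Set E) : Set (Set E) :=
  {F | Convex ℝ F ∧ IsExtreme ℝ P F}

theorem face_subset_doublyStochastic {n : ℕ} (R : Fin n → Fin n → Prop) :
    face R ⊆ doublyStochastic ℝ (Fin n) := by
  rw [doublyStochastic_eq_convexHull_permMatrix]
  refine convexHull_mono ?_
  rintro _ ⟨σ, -, rfl⟩
  exact ⟨σ, (permMat_eq_permMatrix σ).symm⟩

/-- The extreme points of `face R` are exactly the permutation matrices of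
the matchings of `R`. -/
theorem stmt1 (n : ℕ) (R : Fin n → Fin n → Prop) :
    Set.extremePoints ℝ (face R)
      = {M | ∃ σ : Equiv.Perm (Fin n), IsMatching R σ ∧ M = permMat σ} := by
  refine extremePoints_convexHull_subset.antisymm ?_
  rintro _ ⟨σ, hσ, rfl⟩
  refine inter_extremePoints_subset_extremePoints_of_subset (face_subset_doublyStochastic R)
    ⟨subset_convexHull ℝ _ ⟨σ, hσ, rfl⟩, ?_⟩
  rw [extremePoints_doublyStochastic]
  exact ⟨σ, (permMat_eq_permMatrix σ).symm⟩
end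

section
/- Let R : Fin n → Fin n → Prop be an elementary relation that possesses at least one matching, let m be its number of edges, and let k be the number of connected components of the graph G_R. Then the dimension of the face face(R) equals m − 2n + k; precisely, Module.finrank ℝ ↥(vectorSpan ℝ (face R)) + 2 * n = m + k. -/
open Matrix in
/-- A matrix lies in `face R` iff it is doubly stochastic and supported on the edges of `R`. -/
theorem mem_face_iff {n : ℕ} (R : Fin n → Fin n → Prop) (M : Matrix (Fin n) (Fin n) ℝ) :
    M ∈ face R ↔ M ∈ doublyStochastic ℝ (Fin n) ∧ ∀ i j, ¬ R i j → M i j = 0 := by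
  have perm_eq (σ : Equiv.Perm (Fin n)) : σ.permMatrix ℝ = permMat σ := by
    ext i j
    simp [permMat, PEquiv.toMatrix_apply, eq_comm]
  constructor
  · have hconv : Convex ℝ {M : Matrix (Fin n) (Fin n) ℝ |
        M ∈ doublyStochastic ℝ (Fin n) ∧ ∀ i j, ¬ R i j → M i j = 0} := by
      rintro A ⟨hA, hA'⟩ B ⟨hB, hB'⟩ a b ha hb hab
      refine ⟨convex_doublyStochastic hA hB ha hb hab, fun i j hij => ?_⟩
      simp [hA' i j hij, hB' i j hij]
    refine fun hM => convexHull_min ?_ hconv hM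
    rintro _ ⟨σ, hσ, rfl⟩
    refine ⟨perm_eq σ ▸ permMatrix_mem_doublyStochastic, fun i j hij => ?_⟩
    simp only [permMat, ite_eq_right_iff, one_ne_zero, imp_false]
    rintro rfl
    exact hij (hσ i)
  · rintro ⟨hM, hsupp⟩
    obtain ⟨w, hw0, hw1, hwM⟩ := exists_eq_sum_perm_of_mem_doublyStochastic hM
    have := (convex_convexHull ℝ
      {M | ∃ σ : Equiv.Perm (Fin n), IsMatching R σ ∧ M = permMat σ}).finsum_mem
      (w := w) (z := permMat) hw0 (by rwa [finsum_eq_sum_of_fintype]) fun σ hσ => ?_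
    · rw [finsum_eq_sum_of_fintype] at this
      simp only [perm_eq] at hwM
      rwa [hwM] at this
    · refine subset_convexHull ℝ _ ⟨σ, fun i => ?_, rfl⟩
      by_contra hR
      have h0 := hsupp i (σ i) hR
      rw [← hwM, Matrix.sum_apply, Finset.sum_eq_zero_iff_of_nonneg] at h0
      · have := h0 σ (Finset.mem_univ _)
        simp only [perm_eq, Matrix.smul_apply, permMat, if_true, smul_eq_mul, mul_one] at this
        exact hσ this
      · intro τ _
        simp only [perm_eq, Matrix.smul_apply, permMat, smul_eq_mul]
        exact mul_nonneg (hw0 τ) (by split_ifs <;> norm_num)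

/-- The face of an elementary relation contains a matrix that is positive on every edge. -/
theorem exists_mem_face_pos {n : ℕ} {R : Fin n → Fin n → Prop} (hel : IsElementary R)
    (hex : ∃ σ : Equiv.Perm (Fin n), IsMatching R σ) :
    ∃ P ∈ face R, ∀ i j, R i j → 0 < P i j := by
  classical
  set s : Finset (Equiv.Perm (Fin n)) := Finset.univ.filter (IsMatching R) with hs
  have hpos : (0 : ℝ) < s.card := by
    obtain ⟨σ, hσ⟩ := hex
    exact_mod_cast Finset.card_pos.2 ⟨σ, by simpa [hs] using hσ⟩
  refine ⟨∑ σ ∈ s, (s.card : ℝ)⁻¹ • permMat σ, ?_, fun i j hij => ?_⟩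
  · refine (convex_convexHull ℝ _).sum_mem (fun _ _ => by positivity) ?_ fun σ hσ => ?_
    · simp [hpos.ne']
    · exact subset_convexHull ℝ _ ⟨σ, by simpa [hs] using hσ, rfl⟩
  · obtain ⟨σ, hσ, rfl⟩ := hel i j hij
    rw [Matrix.sum_apply]
    refine Finset.sum_pos' (fun τ _ => ?_) ⟨σ, by simpa [hs] using hσ, ?_⟩
    · simp only [Matrix.smul_apply, permMat, smul_eq_mul]
      split_ifs <;> positivity
    · simpa [permMat] using hpos

/-- The matrices supported on the edges of `R` all of whose row and column sums vanish. -/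
def zeroSumSubmodule {n : ℕ} (R : Fin n → Fin n → Prop) :
    Submodule ℝ (Matrix (Fin n) (Fin n) ℝ) where
  carrier := {M | (∀ i j, ¬ R i j → M i j = 0) ∧ (∀ i, ∑ j, M i j = 0) ∧ ∀ j, ∑ i, M i j = 0}
  add_mem' := by
    rintro A B ⟨hA, hA1, hA2⟩ ⟨hB, hB1, hB2⟩
    refine ⟨fun i j h => ?_, fun i => ?_, fun j => ?_⟩
    · simp [hA i j h, hB i j h]
    · simp [Finset.sum_add_distrib, hA1, hB1]
    · simp [Finset.sum_add_distrib, hA2, hB2]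
  zero_mem' := by simp
  smul_mem' := by
    rintro c A ⟨hA, hA1, hA2⟩
    refine ⟨fun i j h => ?_, fun i => ?_, fun j => ?_⟩
    · simp [hA i j h]
    · simp [← Finset.mul_sum, hA1]
    · simp [← Finset.mul_sum, hA2]

theorem mem_zeroSumSubmodule {n : ℕ} {R : Fin n → Fin n → Prop} {M : Matrix (Fin n) (Fin n) ℝ} :
    M ∈ zeroSumSubmodule R ↔
      (∀ i j, ¬ R i j → M i j = 0) ∧ (∀ i, ∑ j, M i j = 0) ∧ ∀ j, ∑ i, M i j = 0 :=
  Iff.rfl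

open Filter Topology in
theorem vectorSpan_face {n : ℕ} {R : Fin n → Fin n → Prop} (hel : IsElementary R)
    (hex : ∃ σ : Equiv.Perm (Fin n), IsMatching R σ) :
    vectorSpan ℝ (face R) = zeroSumSubmodule R := by
  apply le_antisymm
  · refine Submodule.span_le.2 ?_
    rintro _ ⟨A, hA, B, hB, rfl⟩
    simp only [mem_face_iff, mem_doublyStochastic_iff_sum] at hA hB
    obtain ⟨⟨-, hA1, hA2⟩, hA⟩ := hA
    obtain ⟨⟨-, hB1, hB2⟩, hB⟩ := hB
    refine ⟨fun i j h => ?_, fun i => ?_, fun j => ?_⟩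
    · simp [hA i j h, hB i j h]
    · simp [Finset.sum_sub_distrib, hA1, hB1]
    · simp [Finset.sum_sub_distrib, hA2, hB2]
  · rintro M ⟨hM, hM1, hM2⟩
    obtain ⟨P, hP, hPpos⟩ := exists_mem_face_pos hel hex
    have hP' := hP
    simp only [mem_face_iff, mem_doublyStochastic_iff_sum] at hP'
    obtain ⟨⟨-, hP1, hP2⟩, hPsupp⟩ := hP'
    have hev : ∀ᶠ ε : ℝ in 𝓝[>] 0, ∀ i j, 0 ≤ P i j + ε * M i j := by
      refine eventually_all.2 fun i => eventually_all.2 fun j => ?_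
      by_cases hij : R i j
      · have hc : Tendsto (fun ε : ℝ => P i j + ε * M i j) (𝓝 0) (𝓝 (P i j + 0 * M i j)) :=
          Continuous.tendsto (by fun_prop) 0
        refine ((hc.mono_left nhdsWithin_le_nhds).eventually_const_lt ?_).mono fun _ h => h.le
        simpa using hPpos i j hij
      · simp [hM i j hij, hPsupp i j hij]
    obtain ⟨ε, hε, hε0⟩ := (hev.and self_mem_nhdsWithin).exists
    have hmem : P + ε • M ∈ face R := by
      simp only [mem_face_iff, mem_doublyStochastic_iff_sum]
      refine ⟨⟨hε, fun i => ?_, fun j => ?_⟩, fun i j h => ?_⟩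
      · simp [Finset.sum_add_distrib, ← Finset.mul_sum, hM1, hP1]
      · simp [Finset.sum_add_distrib, ← Finset.mul_sum, hM2, hP2]
      · simp [hM i j h, hPsupp i j h]
    have := vsub_mem_vectorSpan ℝ hmem hP
    rw [vsub_eq_sub, add_sub_cancel_left] at this
    exact ((vectorSpan ℝ (face R)).smul_mem_iff (ne_of_gt hε0)).1 this

/-- The oriented incidence matrix of the bipartite graph of `R`. -/
def incidence {n : ℕ} (R : Fin n → Fin n → Prop) :
    Matrix (Fin n ⊕ Fin n) {p : Fin n × Fin n // R p.1 p.2} ℝ :=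
  Matrix.of fun v e =>
    Sum.elim (fun i => if e.1.1 = i then 1 else 0) (fun j => if e.1.2 = j then -1 else 0) v

/-- Restricting a matrix to the edges of `R` identifies `zeroSumSubmodule R` with the kernel of
the incidence matrix. -/
theorem finrank_zeroSumSubmodule {n : ℕ} (R : Fin n → Fin n → Prop)
    [∀ i j, Decidable (R i j)] :
    Module.finrank ℝ (zeroSumSubmodule R) =
      Module.finrank ℝ (LinearMap.ker (incidence R).mulVecLin) := by
  let r : Matrix (Fin n) (Fin n) ℝ →ₗ[ℝ] {p : Fin n × Fin n // R p.1 p.2} → ℝ :=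
    { toFun := fun M e => M e.1.1 e.1.2
      map_add' := fun _ _ => rfl
      map_smul' := fun _ _ => rfl }
  have sum_edges (M : Matrix (Fin n) (Fin n) ℝ) (hM : ∀ i j, ¬ R i j → M i j = 0)
      (c : Fin n × Fin n → ℝ) :
      ∑ e : {p : Fin n × Fin n // R p.1 p.2}, c e.1 * r M e = ∑ i, ∑ j, c (i, j) * M i j := by
    rw [← Fintype.sum_prod_type' (fun i j => c (i, j) * M i j)]
    rw [← Finset.sum_subset (Finset.subset_univ {p : Fin n × Fin n | R p.1 p.2})
      fun p _ hp => by simp [hM p.1 p.2 (by simpa using hp)]]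
    exact (Finset.sum_subtype _ (by simp) fun p : Fin n × Fin n => c p * M p.1 p.2).symm
  have hker (M : Matrix (Fin n) (Fin n) ℝ) (hM : ∀ i j, ¬ R i j → M i j = 0) :
      r M ∈ LinearMap.ker (incidence R).mulVecLin ↔ M ∈ zeroSumSubmodule R := by
    rw [LinearMap.mem_ker, Matrix.mulVecLin_apply, funext_iff, Sum.forall,
      mem_zeroSumSubmodule, and_iff_right hM]
    refine and_congr (forall_congr' fun i => ?_) (forall_congr' fun j => ?_)
    · have := sum_edges M hM fun p => if p.1 = i then 1 else 0
      simp only [Matrix.mulVec, dotProduct, incidence, Matrix.of_apply, Sum.elim_inl, this]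
      simp
    · have := sum_edges M hM fun p => if p.2 = j then -1 else 0
      simp only [Matrix.mulVec, dotProduct, incidence, Matrix.of_apply, Sum.elim_inr, this]
      simp
  have hmap : LinearMap.ker (incidence R).mulVecLin = (zeroSumSubmodule R).map r := by
    ext f
    constructor
    · intro hf
      let M : Matrix (Fin n) (Fin n) ℝ := fun i j => if h : R i j then f ⟨(i, j), h⟩ else 0
      have hrM : r M = f := by
        ext ⟨⟨i, j⟩, h⟩
        exact dif_pos h
      refine ⟨M, (hker M fun i j h => dif_neg h).1 (hrM ▸ hf), hrM⟩
    · rintro ⟨M, hM, rfl⟩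
      exact (hker M hM.1).2 hM
  rw [hmap]
  have hinj : Function.Injective (r.domRestrict (zeroSumSubmodule R)) := by
    rw [injective_iff_map_eq_zero]
    rintro ⟨M, hM⟩ h
    ext i j
    by_cases hij : R i j
    · exact congrFun h ⟨(i, j), hij⟩
    · exact hM.1 i j hij
  rw [← LinearMap.finrank_range_of_inj hinj, LinearMap.range_domRestrict]

open Matrix in
/-- The left kernel of the incidence matrix has the number of components as its dimension. -/
theorem finrank_ker_incidence_transpose {n : ℕ} (R : Fin n → Fin n → Prop)
    [∀ i j, Decidable (R i j)] :
    Module.finrank ℝ (LinearMap.ker (incidence R)ᵀ.mulVecLin) =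
      Nat.card (graphOf R).ConnectedComponent := by
  classical
  rw [Nat.card_eq_fintype_card,
    SimpleGraph.card_connectedComponent_eq_finrank_ker_toLin'_lapMatrix]
  suffices LinearMap.ker (incidence R)ᵀ.mulVecLin =
      LinearMap.ker (toLin' ((graphOf R).lapMatrix ℝ)) by rw [this]
  ext y
  have key : (incidence R)ᵀ *ᵥ y = 0 ↔ ∀ i j, R i j → y (Sum.inl i) = y (Sum.inr j) := by
    simp [funext_iff, mulVec, dotProduct, incidence, Fintype.sum_sum_type, ← sub_eq_add_neg,
      sub_eq_zero]
  rw [LinearMap.mem_ker, LinearMap.mem_ker, mulVecLin_apply, toLin'_apply, key,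
    SimpleGraph.lapMatrix_mulVec_eq_zero_iff_forall_adj]
  constructor
  · rintro h _ _ ⟨-, ⟨i, j, rfl, rfl, hij⟩ | ⟨i, j, rfl, rfl, hij⟩⟩
    · exact h i j hij
    · exact (h i j hij).symm
  · exact fun h i j hij => h _ _ ⟨by simp, Or.inl ⟨i, j, rfl, rfl, hij⟩⟩

/-- Dimension formula: `dim (face R) = m - 2n + k` for an elementary relation `R`
with at least one matching, where `m` is the number of edges and `k` the number of
connected components of `G_R`. -/
theorem stmt2 (n : ℕ) (R : Fin n → Fin n → Prop) [∀ i j, Decidable (R i j)]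
    (hel : IsElementary R) (hex : ∃ σ : Equiv.Perm (Fin n), IsMatching R σ) :
    Module.finrank ℝ ↥(vectorSpan ℝ (face R)) + 2 * n
      = edgeCount R + Nat.card (graphOf R).ConnectedComponent := by
  rw [vectorSpan_face hel hex, finrank_zeroSumSubmodule, ← finrank_ker_incidence_transpose]
  have h1 := (incidence R).mulVecLin.finrank_range_add_finrank_ker
  have h2 := (incidence R).transpose.mulVecLin.finrank_range_add_finrank_ker
  have h3 := (incidence R).rank_transpose
  simp only [Matrix.rank] at h3
  simp only [Module.finrank_fintype_fun_eq_card, Fintype.card_sum, Fintype.card_fin] at h1 h2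
  rw [edgeCount]
  omega
end

section
/- (Billera–Sarangarajan) Let d ≥ 1 and let F be a nonempty face (convex extreme subset) of the Birkhoff polytope B_n with Module.finrank ℝ ↥(vectorSpan ℝ F) = d. Then there exists a face F' of the Birkhoff polytope B_{2d} that is combinatorially isomorphic to F, i.e. there is an order isomorphism, with respect to set inclusion, between the face poset of F and the face poset of F'. Thus every combinatorial type of d-dimensional face of a Birkhoff polytope already appears in B_{2d}. -/
/-- The doubly stochastic matrices supported on `R`. -/
def suppFace {n : ℕ} (R : Fin n → Fin n → Prop) : Set (Matrix (Fin n) (Fin n) ℝ) :=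
  {M | ((∀ i j, 0 ≤ M i j) ∧ (∀ i, ∑ j, M i j = 1) ∧ ∀ j, ∑ i, M i j = 1) ∧
    ∀ i j, ¬ R i j → M i j = 0}

lemma suppFace_subset_doublyStochastic {n : ℕ} (R : Fin n → Fin n → Prop) :
    suppFace R ⊆ (doublyStochastic ℝ (Fin n) : Set (Matrix (Fin n) (Fin n) ℝ)) :=
  fun _ hM => mem_doublyStochastic_iff_sum.2 hM.1

lemma convex_suppFace {n : ℕ} (R : Fin n → Fin n → Prop) : Convex ℝ (suppFace R) := by
  rintro M ⟨hM, hMR⟩ N ⟨hN, hNR⟩ a b ha hb hab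
  refine ⟨mem_doublyStochastic_iff_sum.1 (convex_doublyStochastic
    (mem_doublyStochastic_iff_sum.2 hM) (mem_doublyStochastic_iff_sum.2 hN) ha hb hab), ?_⟩
  intro i j h
  simp [hMR i j h, hNR i j h]

lemma isExtreme_suppFace {n : ℕ} (R : Fin n → Fin n → Prop) :
    IsExtreme ℝ (doublyStochastic ℝ (Fin n) : Set (Matrix (Fin n) (Fin n) ℝ)) (suppFace R) := by
  refine ⟨suppFace_subset_doublyStochastic R, ?_⟩
  rintro M hM N hN P hP ⟨a, b, ha, hb, hab, rfl⟩
  rw [SetLike.mem_coe, mem_doublyStochastic_iff_sum] at hM hN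
  refine ⟨hM, fun i j h => ?_⟩
  have h0 := hP.2 i j h
  simp only [Matrix.add_apply, Matrix.smul_apply, smul_eq_mul] at h0
  have h1 := mul_nonneg ha.le (hM.1 i j)
  have h2 := mul_nonneg hb.le (hN.1 i j)
  have h3 : a * M i j = 0 := by linarith
  exact (mul_eq_zero.1 h3).resolve_left ha.ne'

/-- Every positive entry of a doubly stochastic matrix lies on a positive diagonal. -/
lemma exists_perm_pos_of_mem_doublyStochastic {n : ℕ} {M : Matrix (Fin n) (Fin n) ℝ}
    (hM : M ∈ doublyStochastic ℝ (Fin n)) {i j : Fin n} (hij : 0 < M i j) :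
    ∃ σ : Equiv.Perm (Fin n), (∀ a, 0 < M a (σ a)) ∧ σ i = j := by
  obtain ⟨w, hw, -, hwM⟩ := exists_eq_sum_perm_of_mem_doublyStochastic hM
  have key : ∀ a b, M a b = ∑ σ : Equiv.Perm (Fin n), w σ * (if σ a = b then 1 else 0) := by
    intro a b
    rw [← hwM, Matrix.sum_apply]
    refine Finset.sum_congr rfl fun σ _ => ?_
    simp [Equiv.Perm.permMatrix, PEquiv.toMatrix_apply, eq_comm]
  rw [key] at hij
  obtain ⟨σ, -, hσ⟩ := Finset.exists_lt_of_sum_lt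
    (s := Finset.univ) (f := fun _ : Equiv.Perm (Fin n) => (0 : ℝ)) (by simpa using hij)
  have hσj : σ i = j := by
    by_contra h
    simp [h] at hσ
  have hwσ : 0 < w σ := by simpa [hσj] using hσ
  refine ⟨σ, fun a => ?_, hσj⟩
  rw [key]
  refine Finset.sum_pos' (fun τ _ => mul_nonneg (hw τ) (by split_ifs <;> simp))
    ⟨σ, Finset.mem_univ _, by simpa using hwσ⟩

/-- A matrix in `suppFace R` that is positive on `R` can be moved slightly in every direction
with support in `R` and zero line sums. -/
lemma exists_add_smul_mem_suppFace {n : ℕ} {R : Fin n → Fin n → Prop}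
    {M Y : Matrix (Fin n) (Fin n) ℝ} (hM : M ∈ suppFace R) (hpos : ∀ i j, R i j → 0 < M i j)
    (hY : ∀ i j, ¬ R i j → Y i j = 0) (hrow : ∀ i, ∑ j, Y i j = 0) (hcol : ∀ j, ∑ i, Y i j = 0) :
    ∃ ε : ℝ, 0 < ε ∧ M + ε • Y ∈ suppFace R := by
  have hev : ∀ᶠ ε in nhdsWithin (0 : ℝ) (Set.Ioi 0), ∀ i j, R i j → 0 < M i j + ε * Y i j := by
    refine Filter.eventually_all.2 fun i => Filter.eventually_all.2 fun j => ?_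
    by_cases h : R i j
    · have hc : Filter.Tendsto (fun ε : ℝ => M i j + ε * Y i j) (nhds 0) (nhds (M i j + 0 * Y i j)) :=
        Continuous.tendsto (by fun_prop) 0
      have := (hc.mono_left (nhdsWithin_le_nhds (s := Set.Ioi 0))).eventually
        (lt_mem_nhds (a := 0) (by simpa using hpos i j h))
      exact this.mono fun _ h _ => h
    · simp [h]
  obtain ⟨ε, hε, hε0⟩ := (hev.and self_mem_nhdsWithin).exists
  refine ⟨ε, hε0, ⟨fun i j => ?_, fun i => ?_, fun j => ?_⟩, fun i j h => ?_⟩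
  · by_cases h : R i j
    · exact (hε i j h).le
    · simp [hM.2 i j h, hY i j h]
  · simp [Finset.sum_add_distrib, ← Finset.mul_sum, hrow, hM.1.2.1]
  · simp [Finset.sum_add_distrib, ← Finset.mul_sum, hcol, hM.1.2.2]
  · simp [hM.2 i j h, hY i j h]

/-- Every nonempty face of the Birkhoff polytope consists of the doubly stochastic matrices
supported on an elementary relation. -/
lemma exists_eq_suppFace {n : ℕ} {F : Set (Matrix (Fin n) (Fin n) ℝ)}
    (hne : F.Nonempty) (hconv : Convex ℝ F)
    (hext : IsExtreme ℝ (doublyStochastic ℝ (Fin n) : Set (Matrix (Fin n) (Fin n) ℝ)) F) :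
    ∃ R : Fin n → Fin n → Prop, IsElementary R ∧ F = suppFace R ∧
      ∃ M ∈ F, ∀ i j, R i j → 0 < M i j := by
  have hnn : ∀ M ∈ F, ∀ i j, 0 ≤ M i j := fun M hM i j =>
    nonneg_of_mem_doublyStochastic (hext.subset hM)
  have hS : ∀ s : Finset (Fin n × Fin n), ∃ M ∈ F, ∀ p ∈ s,
      (∃ N ∈ F, 0 < N p.1 p.2) → 0 < M p.1 p.2 := by
    intro s
    induction s using Finset.cons_induction with
    | empty => exact ⟨hne.some, hne.some_mem, by simp⟩
    | cons p s hp ih =>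
      obtain ⟨M, hM, hMs⟩ := ih
      by_cases h : ∃ N ∈ F, 0 < N p.1 p.2
      · obtain ⟨N, hN, hNp⟩ := h
        refine ⟨(1 / 2 : ℝ) • M + (1 / 2 : ℝ) • N,
          hconv hM hN (by norm_num) (by norm_num) (by norm_num), fun q hq hq' => ?_⟩
        have h1 := hnn M hM q.1 q.2
        have h2 := hnn N hN q.1 q.2
        simp only [Matrix.add_apply, Matrix.smul_apply, smul_eq_mul]
        rcases Finset.mem_cons.1 hq with rfl | hq
        · linarith
        · linarith [hMs q hq hq']
      · refine ⟨M, hM, fun q hq hq' => ?_⟩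
        rcases Finset.mem_cons.1 hq with rfl | hq
        · exact absurd hq' h
        · exact hMs q hq hq'
  obtain ⟨M, hM, hpos⟩ := hS Finset.univ
  have hFsub : F ⊆ suppFace fun i j => ∃ N ∈ F, 0 < N i j := by
    intro N hN
    refine ⟨mem_doublyStochastic_iff_sum.1 (hext.subset hN), fun i j h => ?_⟩
    exact le_antisymm (not_lt.1 fun h0 => h ⟨N, hN, h0⟩) (hnn N hN i j)
  refine ⟨fun i j => ∃ N ∈ F, 0 < N i j, ?_, hFsub.antisymm ?_, M, hM,
    fun i j h => hpos (i, j) (Finset.mem_univ _) h⟩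
  · rintro i j ⟨N, hN, hij⟩
    obtain ⟨σ, hσ, hσj⟩ := exists_perm_pos_of_mem_doublyStochastic (hext.subset hN) hij
    exact ⟨σ, fun a => ⟨N, hN, hσ a⟩, hσj⟩
  · intro N hN
    have hMF := hFsub hM
    obtain ⟨ε, hε, hmem⟩ := exists_add_smul_mem_suppFace (Y := M - N) hMF
      (fun i j h => hpos (i, j) (Finset.mem_univ _) h)
      (fun i j h => by simp [hMF.2 i j h, hN.2 i j h])
      (fun i => by simp [hMF.1.2.1, hN.1.2.1]) (fun j => by simp [hMF.1.2.2, hN.1.2.2])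
    refine hext.left_mem_of_mem_openSegment (suppFace_subset_doublyStochastic _ hN)
      (suppFace_subset_doublyStochastic _ hmem) hM
      ⟨ε / (1 + ε), 1 / (1 + ε), by positivity, by positivity, by field_simp; ring, ?_⟩
    ext i j
    simp only [Matrix.add_apply, Matrix.smul_apply, Matrix.sub_apply, smul_eq_mul]
    field_simp
    ring

/-- A linear map that is injective on a convex set induces an isomorphism of face posets. -/
lemma nonempty_facesOf_orderIso {E E' : Type*} [AddCommGroup E] [Module ℝ E] [AddCommGroup E']
    [Module ℝ E'] {P : Set E} (hP : Convex ℝ P) (L : E →ₗ[ℝ] E') (hL : Set.InjOn L P) :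
    Nonempty (facesOf P ≃o facesOf (L '' P)) := by
  have himg : ∀ t ∈ facesOf P, L '' t ∈ facesOf (L '' P) := by
    rintro t ⟨htc, hte⟩
    refine ⟨htc.linear_image L, Set.image_mono hte.subset, ?_⟩
    rintro _ ⟨a, ha, rfl⟩ _ ⟨b, hb, rfl⟩ _ ⟨c, hc, rfl⟩ ⟨u, v, hu, hv, huv, h⟩
    refine ⟨a, hte.left_mem_of_mem_openSegment ha hb hc ⟨u, v, hu, hv, huv, ?_⟩, rfl⟩
    exact hL (hP ha hb hu.le hv.le huv) (hte.subset hc) (by simpa using h)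
  have hpre : ∀ t ∈ facesOf (L '' P), P ∩ L ⁻¹' t ∈ facesOf P := by
    rintro t ⟨htc, hte⟩
    refine ⟨hP.inter (htc.linear_preimage L), Set.inter_subset_left, ?_⟩
    rintro a ha b hb c ⟨hc, hct⟩ ⟨u, v, hu, hv, huv, rfl⟩
    exact ⟨ha, hte.left_mem_of_mem_openSegment ⟨a, ha, rfl⟩ ⟨b, hb, rfl⟩ hct
      ⟨u, v, hu, hv, huv, by simp⟩⟩
  have hleft : ∀ t ∈ facesOf P, P ∩ L ⁻¹' (L '' t) = t := by
    rintro t ⟨-, hte⟩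
    ext x
    constructor
    · rintro ⟨hx, y, hy, hxy⟩
      exact hL (hte.subset hy) hx hxy ▸ hy
    · exact fun hx => ⟨hte.subset hx, x, hx, rfl⟩
  refine ⟨{ toFun := fun t => ⟨L '' t.1, himg t.1 t.2⟩
            invFun := fun t => ⟨P ∩ L ⁻¹' t.1, hpre t.1 t.2⟩
            left_inv := fun t => Subtype.ext (hleft t.1 t.2)
            right_inv := fun t => Subtype.ext ?_
            map_rel_iff' := ?_ }⟩
  · simp only [Set.image_inter_preimage]
    exact Set.inter_eq_right.2 t.2.2.subset
  · intro s t
    refine ⟨fun h => ?_, fun h => Set.image_mono h⟩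
    change s.1 ⊆ t.1
    rw [← hleft s.1 s.2, ← hleft t.1 t.2]
    exact Set.inter_subset_inter_right _ (Set.preimage_mono h)

/-- Contracting a row `v` whose support is contained in two columns, no other row meeting both,
does not change `suppFace R` up to linear equivalence. -/
lemma exists_linearMap_image_suppFace_contract {k : ℕ} {R : Fin (k + 1) → Fin (k + 1) → Prop}
    {v w : Fin (k + 1)} {u : Fin k} (hv : ∀ j, R v j ↔ j = w ∨ j = w.succAbove u)
    (hno : ∀ i, R (v.succAbove i) w → ¬ R (v.succAbove i) (w.succAbove u)) :
    ∃ (R' : Fin k → Fin k → Prop)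
      (L : Matrix (Fin (k + 1)) (Fin (k + 1)) ℝ →ₗ[ℝ] Matrix (Fin k) (Fin k) ℝ),
      Set.InjOn L (suppFace R) ∧ L '' suppFace R = suppFace R' := by
  classical
  let L : Matrix (Fin (k + 1)) (Fin (k + 1)) ℝ →ₗ[ℝ] Matrix (Fin k) (Fin k) ℝ :=
    { toFun := fun M => Matrix.of fun i j => M (v.succAbove i) (w.succAbove j) +
        if j = u then M (v.succAbove i) w else 0
      map_add' := fun M N => by
        ext i j
        by_cases h : j = u
        · simp [h]
          ring
        · simp [h]
      map_smul' := fun c M => by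
        ext i j
        by_cases h : j = u
        · simp [h]
          ring
        · simp [h] }
  have hLap : ∀ M i j, L M i j = M (v.succAbove i) (w.succAbove j) +
      if j = u then M (v.succAbove i) w else 0 := fun _ _ _ => rfl
  have hvz : ∀ M ∈ suppFace R, ∀ j, j ≠ u → M v (w.succAbove j) = 0 := by
    intro M hM j hj
    refine hM.2 _ _ fun h => ?_
    rcases (hv _).1 h with h | h
    · exact Fin.succAbove_ne _ _ h
    · exact hj (Fin.succAbove_right_injective h)
  refine ⟨fun i j => R (v.succAbove i) (w.succAbove j) ∨ j = u ∧ R (v.succAbove i) w, L, ?_, ?_⟩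
  · intro M hM N hN h
    have hent : ∀ i j, M (v.succAbove i) (w.succAbove j) + (if j = u then M (v.succAbove i) w else 0)
        = N (v.succAbove i) (w.succAbove j) + if j = u then N (v.succAbove i) w else 0 :=
      fun i j => congrFun (congrFun h i) j
    have h1 : ∀ i, M (v.succAbove i) w = N (v.succAbove i) w := by
      intro i
      by_cases hR : R (v.succAbove i) w
      · have := hent i u
        simpa [hM.2 _ _ (hno i hR), hN.2 _ _ (hno i hR)] using this
      · rw [hM.2 _ _ hR, hN.2 _ _ hR]
    have h2 : ∀ i j, M (v.succAbove i) j = N (v.succAbove i) j := by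
      intro i j
      refine Fin.succAboveCases w (h1 i) (fun j => ?_) j
      have := hent i j
      rw [h1 i] at this
      exact add_right_cancel this
    ext i j
    refine Fin.succAboveCases v ?_ (fun i => h2 i j) i
    have hMc := hM.1.2.2 j
    have hNc := hN.1.2.2 j
    rw [Fin.sum_univ_succAbove _ v] at hMc hNc
    simp only [h2] at hMc
    linarith
  · apply Set.Subset.antisymm
    · rintro _ ⟨M, hM, rfl⟩
      refine ⟨⟨fun i j => ?_, fun i => ?_, fun j => ?_⟩, fun i j h => ?_⟩
      · rw [hLap]
        have := hM.1.1
        split_ifs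
        · exact add_nonneg (this _ _) (this _ _)
        · simpa using this _ _
      · simp only [hLap, Finset.sum_add_distrib]
        rw [← hM.1.2.1 (v.succAbove i), Fin.sum_univ_succAbove _ w]
        simp [add_comm]
      · simp only [hLap, Finset.sum_add_distrib]
        have hc := hM.1.2.2 (w.succAbove j)
        have hw := hM.1.2.2 w
        have hr := hM.1.2.1 v
        rw [Fin.sum_univ_succAbove _ v] at hc hw
        rw [Fin.sum_univ_succAbove _ w,
          Finset.sum_eq_single u (fun j _ hj => hvz M hM j hj) (by simp)] at hr
        by_cases hj : j = u
        · subst hj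
          simp only [if_true]
          linarith
        · rw [hvz M hM j hj] at hc
          simpa [hj] using hc
      · rw [hLap, hM.2 _ _ fun h' => h (Or.inl h')]
        split_ifs with hj
        · rw [hM.2 _ _ fun h' => h (Or.inr ⟨hj, h'⟩)]; simp
        · simp
    · intro N hN
      let P : Fin k → Fin (k + 1) → ℝ := fun i =>
        Fin.insertNth (α := fun _ => ℝ) w (if R (v.succAbove i) w then N i u else 0)
          fun j => if R (v.succAbove i) (w.succAbove j) then N i j else 0
      let M : Matrix (Fin (k + 1)) (Fin (k + 1)) ℝ :=
        Fin.insertNth (α := fun _ => Fin (k + 1) → ℝ) v (fun j => 1 - ∑ i, P i j) P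
      have hMv : ∀ j, M v j = 1 - ∑ i, P i j := fun j =>
        congrFun (Fin.insertNth_apply_same (α := fun _ => Fin (k + 1) → ℝ) v _ P) j
      have hMa : ∀ i j, M (v.succAbove i) j = P i j := fun i j =>
        congrFun (Fin.insertNth_apply_succAbove (α := fun _ => Fin (k + 1) → ℝ) v _ P i) j
      have hPw : ∀ i, P i w = if R (v.succAbove i) w then N i u else 0 := fun i =>
        Fin.insertNth_apply_same (α := fun _ => ℝ) w _ _
      have hPa : ∀ i j, P i (w.succAbove j) =
          if R (v.succAbove i) (w.succAbove j) then N i j else 0 := fun i j =>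
        Fin.insertNth_apply_succAbove (α := fun _ => ℝ) w _ _ j
      have hPne : ∀ i j, j ≠ u → P i (w.succAbove j) = N i j := by
        intro i j hj
        rw [hPa]
        split_ifs with h
        · rfl
        · exact (hN.2 i j (by simp [h, hj])).symm
      have hPu : ∀ i, P i w + P i (w.succAbove u) = N i u := by
        intro i
        rw [hPw, hPa]
        by_cases h1 : R (v.succAbove i) w
        · simp [h1, hno i h1]
        · by_cases h2 : R (v.succAbove i) (w.succAbove u)
          · simp [h1, h2]
          · simp [h1, h2, hN.2 i u (by simp [h1, h2])]
      have hP0 : ∀ i j, 0 ≤ P i j := by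
        intro i j
        refine Fin.succAboveCases w ?_ (fun j => ?_) j
        · rw [hPw]; split_ifs <;> simp [hN.1.1]
        · rw [hPa]; split_ifs <;> simp [hN.1.1]
      have hsumu : ∑ i, P i w + ∑ i, P i (w.succAbove u) = 1 := by
        rw [← Finset.sum_add_distrib, ← hN.1.2.2 u]
        exact Finset.sum_congr rfl fun i _ => hPu i
      have hsumne : ∀ j, j ≠ u → ∑ i, P i (w.succAbove j) = 1 := by
        intro j hj
        rw [← hN.1.2.2 j]
        exact Finset.sum_congr rfl fun i _ => hPne i j hj
      have hs0 : ∀ j, 0 ≤ ∑ i, P i j := fun j => Finset.sum_nonneg fun i _ => hP0 i j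
      refine ⟨M, ⟨⟨fun i j => ?_, fun i => ?_, fun j => ?_⟩, fun i j h => ?_⟩, ?_⟩
      · refine Fin.succAboveCases v ?_ (fun i => ?_) i
        · rw [hMv]
          refine Fin.succAboveCases w ?_ (fun j => ?_) j
          · linarith [hs0 (w.succAbove u)]
          · by_cases hj : j = u
            · subst hj; linarith [hs0 w]
            · rw [hsumne j hj]; simp
        · rw [hMa]; exact hP0 i j
      · refine Fin.succAboveCases v ?_ (fun i => ?_) i
        · rw [Fin.sum_univ_succAbove _ w, Finset.sum_eq_single u _ (by simp)]
          · rw [hMv, hMv]; linarith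
          · intro j _ hj
            rw [hMv, hsumne j hj, sub_self]
        · rw [Fin.sum_univ_succAbove _ w]
          simp only [hMa]
          rw [← hN.1.2.1 i, ← Finset.add_sum_erase _ _ (Finset.mem_univ u),
            ← Finset.add_sum_erase (Finset.univ) (N i) (Finset.mem_univ u), ← hPu i, add_assoc]
          congr 2
          exact Finset.sum_congr rfl fun j hj => hPne i j (Finset.ne_of_mem_erase hj)
      · rw [Fin.sum_univ_succAbove _ v, hMv]
        simp [hMa]
      · revert h
        refine Fin.succAboveCases v (fun h => ?_) (fun i => ?_) i
        · rw [hv] at h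
          revert h
          refine Fin.succAboveCases w (fun h => absurd (Or.inl rfl) h) (fun j h => ?_) j
          rw [hMv, hsumne j (fun hj => h (Or.inr (by rw [hj]))), sub_self]
        · rw [hMa]
          refine Fin.succAboveCases w (fun h => ?_) (fun j h => ?_) j
          · rw [hPw, if_neg h]
          · rw [hPa, if_neg h]
      · ext i j
        rw [hLap, hMa, hMa]
        by_cases hj : j = u
        · subst hj
          rw [if_pos rfl, add_comm, hPu]
        · rw [if_neg hj, hPne i j hj, add_zero]

/-- Appending a fixed diagonal entry does not change `suppFace R` up to linear equivalence. -/
lemma exists_linearMap_image_suppFace_pad {k : ℕ} (R : Fin k → Fin k → Prop) :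
    ∃ (R' : Fin (k + 1) → Fin (k + 1) → Prop)
      (L : Matrix (Fin (k + 1)) (Fin (k + 1)) ℝ →ₗ[ℝ] Matrix (Fin k) (Fin k) ℝ),
      Set.InjOn L (suppFace R') ∧ L '' suppFace R' = suppFace R := by
  let R' : Fin (k + 1) → Fin (k + 1) → Prop := fun i =>
    Fin.cases (motive := fun _ => Fin (k + 1) → Prop)
      (fun j => j = 0) (fun i j => ∃ j', j = Fin.succ j' ∧ R i j') i
  have h0 : ∀ j : Fin k, ¬ R' 0 j.succ := fun j => by simp [R', Fin.succ_ne_zero]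
  have h1 : ∀ i : Fin k, ¬ R' i.succ 0 := fun i => by simp [R', (Fin.succ_ne_zero _).symm]
  have h2 : ∀ i j : Fin k, R' i.succ j.succ ↔ R i j := fun i j => by simp [R']
  have hM0 : ∀ M ∈ suppFace R', M 0 0 = 1 := by
    intro M hM
    have := hM.1.2.1 0
    rw [Fin.sum_univ_succ] at this
    simpa [hM.2 _ _ (h0 _)] using this
  let L : Matrix (Fin (k + 1)) (Fin (k + 1)) ℝ →ₗ[ℝ] Matrix (Fin k) (Fin k) ℝ :=
    { toFun := fun M => Matrix.of fun i j => M i.succ j.succ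
      map_add' := fun M N => by ext i j; simp
      map_smul' := fun c M => by ext i j; simp }
  have hLap : ∀ M i j, L M i j = M i.succ j.succ := fun _ _ _ => rfl
  refine ⟨R', L, ?_, ?_⟩
  · intro M hM N hN h
    ext i j
    refine Fin.cases ?_ (fun i => ?_) i
    · refine Fin.cases ?_ (fun j => ?_) j
      · rw [hM0 M hM, hM0 N hN]
      · rw [hM.2 _ _ (h0 j), hN.2 _ _ (h0 j)]
    · refine Fin.cases ?_ (fun j => ?_) j
      · rw [hM.2 _ _ (h1 i), hN.2 _ _ (h1 i)]
      · exact congrFun (congrFun h i) j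
  · apply Set.Subset.antisymm
    · rintro _ ⟨M, hM, rfl⟩
      refine ⟨⟨fun i j => hM.1.1 _ _, fun i => ?_, fun j => ?_⟩, fun i j h => ?_⟩
      · have := hM.1.2.1 i.succ
        rw [Fin.sum_univ_succ, hM.2 _ _ (h1 i), zero_add] at this
        exact this
      · have := hM.1.2.2 j.succ
        rw [Fin.sum_univ_succ, hM.2 _ _ (h0 j), zero_add] at this
        exact this
      · exact hM.2 _ _ (by rwa [h2])
    · intro N hN
      let M : Matrix (Fin (k + 1)) (Fin (k + 1)) ℝ := fun i =>
        Fin.cases (motive := fun _ => Fin (k + 1) → ℝ)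
          (fun j => Fin.cases (motive := fun _ => ℝ) 1 (fun _ => 0) j)
          (fun i j => Fin.cases (motive := fun _ => ℝ) 0 (fun j => N i j) j) i
      have m0 : M 0 0 = 1 := rfl
      have m1 : ∀ j : Fin k, M 0 j.succ = 0 := fun _ => rfl
      have m2 : ∀ i : Fin k, M i.succ 0 = 0 := fun _ => rfl
      have m3 : ∀ i j : Fin k, M i.succ j.succ = N i j := fun _ _ => rfl
      refine ⟨M, ⟨⟨fun i j => ?_, fun i => ?_, fun j => ?_⟩, fun i j => ?_⟩, ?_⟩
      · refine Fin.cases (Fin.cases ?_ (fun j => ?_) j) (fun i => Fin.cases ?_ (fun j => ?_) j) i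
        · simp [m0]
        · simp [m1]
        · simp [m2]
        · simp [m3, hN.1.1]
      · rw [Fin.sum_univ_succ]
        refine Fin.cases ?_ (fun i => ?_) i
        · simp [m0, m1]
        · simp [m2, m3, hN.1.2.1]
      · rw [Fin.sum_univ_succ]
        refine Fin.cases ?_ (fun j => ?_) j
        · simp [m0, m2]
        · simp [m1, m3, hN.1.2.2]
      · refine Fin.cases (Fin.cases ?_ (fun j => ?_) j) (fun i => Fin.cases ?_ (fun j => ?_) j) i
        · exact fun h => absurd rfl h
        · exact fun _ => m1 j
        · exact fun _ => m2 i
        · exact fun h => hN.2 i j (by rwa [h2] at h)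
      · ext i j
        exact m3 i j

open Classical in
/-- A lower bound for the dimension of `suppFace R`: the number of edges plus the number of
pairwise disjoint closed blocks, each given by the support of a row, minus `2 * n`. -/
lemma card_add_card_le_finrank_vectorSpan {n : ℕ} {R : Fin n → Fin n → Prop}
    {M : Matrix (Fin n) (Fin n) ℝ} (hM : M ∈ suppFace R) (hpos : ∀ i j, R i j → 0 < M i j)
    (hex : ∀ u, ∃ j, R u j) (S : Finset (Fin n))
    (hdisj : ∀ u ∈ S, ∀ u' ∈ S, ∀ j, R u j → R u' j → u = u')
    (hcl : ∀ u ∈ S, ∀ i j j', R u j → R i j → R i j' → R u j') :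
    (Finset.univ.filter fun p : Fin n × Fin n => R p.1 p.2).card + S.card ≤
      Module.finrank ℝ (vectorSpan ℝ (suppFace R)) + 2 * n := by
  choose q hq using hex
  have hqinj : Set.InjOn q S := fun u hu u' hu' h =>
    hdisj u hu u' hu' (q u) (hq u) (h ▸ hq u')
  set K := S.image q with hK
  have hKcard : K.card = S.card := Finset.card_image_of_injOn hqinj
  let Ψ : Matrix (Fin n) (Fin n) ℝ →ₗ[ℝ]
      ({p : Fin n × Fin n // ¬ R p.1 p.2} → ℝ) × (Fin n → ℝ) × ({j // j ∉ K} → ℝ) :=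
    { toFun := fun Y => (fun p => Y p.1.1 p.1.2, fun i => ∑ j, Y i j, fun j => ∑ i, Y i j)
      map_add' := fun Y Z => by ext <;> simp [Finset.sum_add_distrib]
      map_smul' := fun c Y => by ext <;> simp [Finset.mul_sum] }
  have hker : LinearMap.ker Ψ ≤ vectorSpan ℝ (suppFace R) := by
    intro Y hY
    have hY' : Ψ Y = 0 := hY
    have hsupp : ∀ i j, ¬ R i j → Y i j = 0 := fun i j h =>
      congrFun (congrArg Prod.fst hY') ⟨(i, j), h⟩
    have hrow : ∀ i, ∑ j, Y i j = 0 := fun i =>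
      congrFun (congrArg (fun z => z.2.1) hY') i
    have hcol' : ∀ j, j ∉ K → ∑ i, Y i j = 0 := fun j hj =>
      congrFun (congrArg (fun z => z.2.2) hY') ⟨j, hj⟩
    have hcol : ∀ j, ∑ i, Y i j = 0 := by
      intro j
      by_cases hj : j ∈ K
      · obtain ⟨u, hu, rfl⟩ := Finset.mem_image.1 hj
        have h1 : ∀ i, ∑ j ∈ Finset.univ.filter (R u), Y i j = 0 := by
          intro i
          by_cases hi : ∃ j, R u j ∧ R i j
          · obtain ⟨j, huj, hij⟩ := hi
            rw [← hrow i]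
            refine Finset.sum_subset (Finset.filter_subset _ _) fun j' _ hj' => ?_
            refine hsupp _ _ fun h => hj' ?_
            simpa using hcl u hu i j j' huj hij h
          · refine Finset.sum_eq_zero fun j' hj' => hsupp _ _ fun h => hi ⟨j', ?_, h⟩
            simpa using hj'
        have h2 : ∑ j ∈ Finset.univ.filter (R u), ∑ i, Y i j = 0 := by
          rw [Finset.sum_comm]
          exact Finset.sum_eq_zero fun i _ => h1 i
        rw [Finset.sum_eq_single (q u)] at h2
        · exact h2
        · intro j hj hne
          refine hcol' j fun hjK => hne ?_
          obtain ⟨u', hu', rfl⟩ := Finset.mem_image.1 hjK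
          rw [hdisj u hu u' hu' (q u') (by simpa using hj) (hq u')]
        · exact fun h => absurd (hq u) (by simpa using h)
      · exact hcol' j hj
    obtain ⟨ε, hε, hmem⟩ := exists_add_smul_mem_suppFace hM hpos hsupp hrow hcol
    have h := vsub_mem_vectorSpan ℝ hmem hM
    rw [vsub_eq_sub, add_sub_cancel_left] at h
    simpa [smul_smul, hε.ne'] using (vectorSpan ℝ (suppFace R)).smul_mem ε⁻¹ h
  have h1 := Submodule.finrank_mono hker
  have h2 := Ψ.finrank_range_add_finrank_ker
  have h3 := Submodule.finrank_le (LinearMap.range Ψ)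
  have h4 : Fintype.card {j // j ∉ K} + S.card = n := by
    have := Fintype.card_subtype_compl (fun j => j ∈ K)
    have hle := Finset.card_le_univ K
    simp only [Fintype.card_coe, Fintype.card_fin] at this hle
    omega
  have h5 : Fintype.card {p : Fin n × Fin n // ¬ R p.1 p.2} +
      (Finset.univ.filter fun p : Fin n × Fin n => R p.1 p.2).card = n * n := by
    rw [Fintype.card_subtype, add_comm, Finset.card_filter_add_card_filter_not]
    simp
  simp only [Module.finrank_prod, Module.finrank_fintype_fun_eq_card, Fintype.card_fin,
    Module.finrank_matrix, Module.finrank_self, mul_one] at h2 h3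
  omega

open Classical in
/-- If every row has at least two edges and every row with two edges is dominated by another
row, then there are disjoint closed blocks making the number of rows at most twice the
dimension bound. -/
lemma exists_blocks_of_dominated {n : ℕ} {R : Fin n → Fin n → Prop} (hR : IsElementary R)
    (hdeg : ∀ i, 2 ≤ (Finset.univ.filter (R i)).card)
    (hdom : ∀ i, (Finset.univ.filter (R i)).card = 2 → ∃ u, u ≠ i ∧ ∀ j, R i j → R u j) :
    ∃ S : Finset (Fin n), (∀ u ∈ S, ∀ u' ∈ S, ∀ j, R u j → R u' j → u = u') ∧
      (∀ u ∈ S, ∀ i j j', R u j → R i j → R i j' → R u j') ∧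
      5 * n ≤ 2 * ((Finset.univ.filter fun p : Fin n × Fin n => R p.1 p.2).card + S.card) := by
  set N : Fin n → Finset (Fin n) := fun i => Finset.univ.filter (R i) with hN
  have memN : ∀ i j, j ∈ N i ↔ R i j := fun i j => by simp [hN]
  set T : Fin n → Finset (Fin n) := fun u => Finset.univ.filter fun i => N i ⊆ N u with hT
  have memT : ∀ u i, i ∈ T u ↔ N i ⊆ N u := fun u i => by simp [hT]
  have hmaps : ∀ (σ : Equiv.Perm (Fin n)), IsMatching R σ → ∀ u,
      Set.MapsTo σ (T u) (N u) := fun σ hσ u i hi =>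
    (memT u i).1 hi ((memN _ _).2 (hσ i))
  have hTle : ∀ u, (T u).card ≤ (N u).card := by
    intro u
    obtain ⟨j, hj⟩ := Finset.card_pos.1 (lt_of_lt_of_le two_pos (hdeg u))
    obtain ⟨σ, hσ, -⟩ := hR u j (by simpa using hj)
    exact Finset.card_le_card_of_injOn σ (hmaps σ hσ u) σ.injective.injOn
  have hclosed : ∀ u, (N u).card ≤ (T u).card → ∀ i j, j ∈ N u → j ∈ N i → N i ⊆ N u := by
    intro u hu i j hju hji
    obtain ⟨σ, hσ, hij⟩ := hR i j ((memN _ _).1 hji)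
    obtain ⟨i', hi', h⟩ := Finset.surjOn_of_injOn_of_card_le σ (hmaps σ hσ u)
      σ.injective.injOn hu hju
    rw [← hij] at h
    rw [← σ.injective h]
    exact (memT _ _).1 hi'
  obtain ⟨S, hStight, hSinj, hSimg⟩ := Finset.exists_subset_injOn_image_eq_of_surjOn (f := N)
    {u | (N u).card ≤ (T u).card}
    ((Finset.univ.filter fun u => (N u).card ≤ (T u).card).image N)
    (by intro A hA; simpa using hA)
  refine ⟨S, ?_, ?_, ?_⟩
  · intro u hu u' hu' j h h'
    rw [← memN] at h h'
    exact hSinj hu hu' ((hclosed u' (hStight hu') u j h' h).antisymm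
      (hclosed u (hStight hu) u' j h h'))
  · intro u hu i j j' h h' h''
    rw [← memN] at *
    exact hclosed u (hStight hu) i j h h' h''
  have hcenter : ∀ i, ∃ c, N i ⊆ N c ∧ (c ∈ S ∨ 3 ≤ (N c).card ∧ (T c).card < (N c).card) := by
    intro i
    by_cases hi : ∃ u, (N u).card ≤ (T u).card ∧ N i ⊆ N u
    · obtain ⟨u, hu, hiu⟩ := hi
      have : N u ∈ S.image N := hSimg ▸ Finset.mem_image_of_mem N (by simpa using hu)
      obtain ⟨c, hc, hcu⟩ := Finset.mem_image.1 this
      exact ⟨c, hcu ▸ hiu, Or.inl hc⟩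
    · push Not at hi
      have hlt : ∀ u, N i ⊆ N u → (T u).card < (N u).card := fun u hu =>
        not_le.1 fun h => hi u h hu
      by_cases h3 : 3 ≤ (N i).card
      · exact ⟨i, subset_rfl, Or.inr ⟨h3, hlt i subset_rfl⟩⟩
      · have h2 : (N i).card = 2 := by
          have : 2 ≤ (N i).card := hdeg i
          omega
        obtain ⟨u, hui, hu⟩ := hdom i h2
        have hsub : N i ⊆ N u := fun j hj => (memN _ _).2 (hu j ((memN _ _).1 hj))
        refine ⟨u, hsub, Or.inr ⟨?_, hlt u hsub⟩⟩
        by_contra h3u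
        have heq : N i = N u := Finset.eq_of_subset_of_card_le hsub (by omega)
        have hpair : ({i, u} : Finset (Fin n)) ⊆ T i := by
          intro x hx
          rcases Finset.mem_insert.1 hx with rfl | hx
          · exact (memT _ _).2 subset_rfl
          · rw [Finset.mem_singleton.1 hx]
            exact (memT _ _).2 heq.symm.subset
        have := Finset.card_le_card hpair
        rw [Finset.card_pair hui.symm] at this
        have := hlt i subset_rfl
        omega
  choose c hcN hc using hcenter
  have hfib : ∀ u, (Finset.univ.filter fun i => c i = u).card + 4 ≤
      2 * (N u).card + 2 * if u ∈ S then 1 else 0 := by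
    intro u
    have hle : (Finset.univ.filter fun i => c i = u).card ≤ (T u).card := by
      refine Finset.card_le_card fun i hi => ?_
      rw [memT, ← (Finset.mem_filter.1 hi).2]
      exact hcN i
    have h1 := hTle u
    have h2 : 2 ≤ (N u).card := hdeg u
    by_cases hu : u ∈ S
    · rw [if_pos hu]
      omega
    · rw [if_neg hu]
      rcases Finset.eq_empty_or_nonempty (Finset.univ.filter fun i => c i = u) with h | ⟨i, hi⟩
      · rw [h, Finset.card_empty]
        omega
      · obtain rfl := (Finset.mem_filter.1 hi).2
        have := (hc i).resolve_left hu
        omega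
  have hsum := Finset.sum_le_sum fun u (_ : u ∈ Finset.univ) => hfib u
  have hE : (Finset.univ.filter fun p : Fin n × Fin n => R p.1 p.2).card = ∑ u, (N u).card := by
    simp only [hN, Finset.card_filter, Fintype.sum_prod_type]
  have hn : ∑ u, (Finset.univ.filter fun i => c i = u).card = n := by
    rw [← Finset.card_eq_sum_card_fiberwise (fun _ _ => Finset.mem_univ _)]
    simp
  simp only [Finset.sum_add_distrib, ← Finset.mul_sum, hn, ← hE, Finset.sum_const,
    Finset.card_univ, Fintype.card_fin, smul_eq_mul, Finset.sum_ite_mem, Finset.univ_inter] at hsum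
  omega

/-- A row of an elementary relation with at most two edges that is not dominated by another row
can be contracted. -/
lemma exists_linearMap_image_suppFace_of_not_dominated {k : ℕ} (hk : 1 ≤ k)
    {R : Fin (k + 1) → Fin (k + 1) → Prop} (hR : IsElementary R) {v : Fin (k + 1)}
    (h : (∃ w, ∀ j, R v j ↔ j = w) ∨
      ∃ w w', w' ≠ w ∧ (∀ j, R v j ↔ j = w ∨ j = w') ∧
        ¬ ∃ u, u ≠ v ∧ ∀ j, R v j → R u j) :
    ∃ (R' : Fin k → Fin k → Prop)
      (L : Matrix (Fin (k + 1)) (Fin (k + 1)) ℝ →ₗ[ℝ] Matrix (Fin k) (Fin k) ℝ),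
      Set.InjOn L (suppFace R) ∧ L '' suppFace R = suppFace R' := by
  rcases h with ⟨w, hw⟩ | ⟨w, w', hne, hww, hno⟩
  · have honly : ∀ i, R i w → i = v := by
      intro i hi
      obtain ⟨σ, hσ, hiw⟩ := hR i w hi
      have := (hw _).1 (hσ v)
      exact σ.injective (hiw.trans this.symm)
    let u : Fin k := ⟨0, hk⟩
    have heq : suppFace R = suppFace fun i j => R i j ∨ i = v ∧ j = w.succAbove u := by
      apply Set.Subset.antisymm
      · exact fun M hM => ⟨hM.1, fun i j h => hM.2 i j fun h' => h (Or.inl h')⟩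
      · intro M hM
        have hvw : M v w = 1 := by
          rw [← hM.1.2.2 w, Finset.sum_eq_single v _ (by simp)]
          intro i _ hi
          refine hM.2 _ _ ?_
          rintro (h | h)
          · exact hi (honly i h)
          · exact hi h.1
        have hvu : M v (w.succAbove u) = 0 := by
          have := hM.1.2.1 v
          rw [Fin.sum_univ_succAbove _ w, hvw, add_eq_left,
            Finset.sum_eq_zero_iff_of_nonneg fun j _ => hM.1.1 _ _] at this
          exact this u (Finset.mem_univ _)
        refine ⟨hM.1, fun i j h => ?_⟩
        by_cases h' : i = v ∧ j = w.succAbove u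
        · rw [h'.1, h'.2, hvu]
        · exact hM.2 i j (by simp [h, h'])
    rw [heq]
    refine exists_linearMap_image_suppFace_contract (v := v) (w := w) (u := u)
      (fun j => by simp [hw]) fun i hi => ?_
    rcases hi with hi | hi
    · exact absurd (honly _ hi) (Fin.succAbove_ne _ _)
    · exact absurd hi.1 (Fin.succAbove_ne _ _)
  · obtain ⟨u, rfl⟩ := Fin.exists_succAbove_eq hne
    refine exists_linearMap_image_suppFace_contract hww fun i hi hi' =>
      hno ⟨v.succAbove i, Fin.succAbove_ne _ _, fun j hj => ?_⟩
    rcases (hww j).1 hj with rfl | rfl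
    · exact hi
    · exact hi'

/-- Faces of Birkhoff polytopes can be padded. -/
lemma exists_orderIso_suppFace_of_le {m k : ℕ} (hmk : m ≤ k) (R : Fin m → Fin m → Prop) :
    ∃ R' : Fin k → Fin k → Prop, Nonempty (facesOf (suppFace R) ≃o facesOf (suppFace R')) := by
  induction k, hmk using Nat.le_induction with
  | base => exact ⟨R, ⟨OrderIso.refl _⟩⟩
  | succ k _ ih =>
    obtain ⟨R', ⟨e⟩⟩ := ih
    obtain ⟨R'', L, hL, himg⟩ := exists_linearMap_image_suppFace_pad R'
    obtain ⟨e'⟩ := nonempty_facesOf_orderIso (convex_suppFace R'') L hL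
    rw [himg] at e'
    exact ⟨R'', ⟨e.trans e'.symm⟩⟩

/-- A face of positive dimension `d` is linearly equivalent to a face of a Birkhoff polytope of
size at most `2 * d`. -/
lemma exists_linearMap_image_eq_suppFace {d n : ℕ} (hd : 1 ≤ d)
    {F : Set (Matrix (Fin n) (Fin n) ℝ)} (hne : F.Nonempty) (hconv : Convex ℝ F)
    (hext : IsExtreme ℝ (doublyStochastic ℝ (Fin n) : Set (Matrix (Fin n) (Fin n) ℝ)) F)
    (hdim : Module.finrank ℝ (vectorSpan ℝ F) = d) :
    ∃ m ≤ 2 * d, ∃ (R : Fin m → Fin m → Prop)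
      (L : Matrix (Fin n) (Fin n) ℝ →ₗ[ℝ] Matrix (Fin m) (Fin m) ℝ),
      Set.InjOn L F ∧ L '' F = suppFace R := by
  classical
  have hexists : ∃ m, ∃ (R : Fin m → Fin m → Prop)
      (L : Matrix (Fin n) (Fin n) ℝ →ₗ[ℝ] Matrix (Fin m) (Fin m) ℝ),
      Set.InjOn L F ∧ L '' F = suppFace R := by
    obtain ⟨R, -, hFR, -⟩ := exists_eq_suppFace hne hconv hext
    exact ⟨n, R, LinearMap.id, Set.injOn_id _, by simpa using hFR⟩
  obtain ⟨m, hm, hmin⟩ : ∃ m, (∃ (R : Fin m → Fin m → Prop)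
      (L : Matrix (Fin n) (Fin n) ℝ →ₗ[ℝ] Matrix (Fin m) (Fin m) ℝ),
      Set.InjOn L F ∧ L '' F = suppFace R) ∧ ∀ k < m, ¬ ∃ (R : Fin k → Fin k → Prop)
      (L : Matrix (Fin n) (Fin n) ℝ →ₗ[ℝ] Matrix (Fin k) (Fin k) ℝ),
      Set.InjOn L F ∧ L '' F = suppFace R :=
    ⟨Nat.find hexists, Nat.find_spec hexists, fun k hk => Nat.find_min hexists hk⟩
  refine ⟨m, not_lt.1 fun hlt => ?_, hm⟩
  obtain ⟨R₀, L, hL, hLF⟩ := hm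
  obtain ⟨R, hR, hRR, M, hM, hpos⟩ := exists_eq_suppFace (hLF ▸ hne.image L)
    (convex_suppFace R₀) (isExtreme_suppFace R₀)
  rw [hRR] at hM hLF
  obtain ⟨k, rfl⟩ : ∃ k, m = k + 1 := ⟨m - 1, by omega⟩
  have hrow : ∀ i, ∃ j, R i j := by
    intro i
    by_contra! h
    have := hM.1.2.1 i
    simp [hM.2 i _ (h _)] at this
  have hirr : ∀ v, ¬ ((∃ w, ∀ j, R v j ↔ j = w) ∨
      ∃ w w', w' ≠ w ∧ (∀ j, R v j ↔ j = w ∨ j = w') ∧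
        ¬ ∃ u, u ≠ v ∧ ∀ j, R v j → R u j) := by
    intro v h
    obtain ⟨R', L', hL', hLR'⟩ :=
      exists_linearMap_image_suppFace_of_not_dominated (by omega) hR h
    refine hmin k (Nat.lt_succ_self k) ⟨R', L' ∘ₗ L, ?_, ?_⟩
    · rw [← hLF] at hL'
      exact hL'.comp hL (Set.mapsTo_image L F)
    · rw [← hLR', ← hLF, ← Set.image_comp]
      rfl
  obtain ⟨S, hdisj, hcl, hcard⟩ := exists_blocks_of_dominated hR (fun i => by
      by_contra! h
      have hp : 0 < (Finset.univ.filter (R i)).card :=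
        Finset.card_pos.2 ((hrow i).imp fun j hj => by simpa using hj)
      obtain ⟨w, hw⟩ := Finset.card_eq_one.1 (show (Finset.univ.filter (R i)).card = 1 by omega)
      exact hirr i (Or.inl ⟨w, fun j => by simpa using Finset.ext_iff.1 hw j⟩)) (fun i hi => by
      by_contra h
      obtain ⟨w, w', hww, hw⟩ := Finset.card_eq_two.1 hi
      exact hirr i (Or.inr ⟨w, w', hww.symm, fun j => by simpa using Finset.ext_iff.1 hw j, h⟩))
  have hle := card_add_card_le_finrank_vectorSpan hM hpos hrow S hdisj hcl
  have hspan : Submodule.map L (vectorSpan ℝ F) = vectorSpan ℝ (suppFace R) := by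
    rw [← hLF]
    exact L.toAffineMap.map_vectorSpan
  have hfin := Submodule.finrank_map_le L (vectorSpan ℝ F)
  rw [hspan, hdim] at hfin
  omega

/-- Billera–Sarangarajan: every combinatorial type of a `d`-dimensional face of a
Birkhoff polytope already appears in `B_{2d}`. -/
theorem stmt3 (d n : ℕ) (hd : 1 ≤ d) (F : Set (Matrix (Fin n) (Fin n) ℝ))
    (hne : F.Nonempty) (hconv : Convex ℝ F)
    (hext : IsExtreme ℝ (doublyStochastic ℝ (Fin n) : Set (Matrix (Fin n) (Fin n) ℝ)) F)
    (hdim : Module.finrank ℝ ↥(vectorSpan ℝ F) = d) :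
    ∃ F' : Set (Matrix (Fin (2 * d)) (Fin (2 * d)) ℝ),
      Convex ℝ F' ∧
      IsExtreme ℝ (doublyStochastic ℝ (Fin (2 * d)) : Set (Matrix (Fin (2 * d)) (Fin (2 * d)) ℝ)) F' ∧
      Nonempty (↥(facesOf F) ≃o ↥(facesOf F')) := by
  obtain ⟨m, hm, R, L, hL, hLF⟩ := exists_linearMap_image_eq_suppFace hd hne hconv hext hdim
  obtain ⟨e⟩ := nonempty_facesOf_orderIso hconv L hL
  rw [hLF] at e
  obtain ⟨R', ⟨e'⟩⟩ := exists_orderIso_suppFace_of_le hm R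
  exact ⟨suppFace R', convex_suppFace R', isExtreme_suppFace R', ⟨e.trans e'⟩⟩
end

section
/- Let R : Fin n → Fin n → Prop be elementary, let v be an upper node of degree 2 with distinct neighbors w₁, w₂ (so R v w₁, R v w₂, and no other j satisfies R v j), and let N := {u : Fin n | u ≠ v ∧ R u w₁ ∧ R u w₂}. Assume N is nonempty (i.e. v is an irreducible node). Then either (i) the support of the connected component of Sum.inl v in G_R equals {Sum.inl v} ∪ {Sum.inl u | u ∈ N} ∪ {Sum.inr w₁, Sum.inr w₂}, and in this case N has exactly one element; or (ii) every u ∈ N has upper degree ≥ 3, and at least one of w₁, w₂ has lower degree ≥ 3. -/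
theorem three_le_card_subtype {α : Type*} {p : α → Prop} [Fintype {x // p x}] {a b c : α}
    (ha : p a) (hb : p b) (hc : p c) (hab : a ≠ b) (hac : a ≠ c) (hbc : b ≠ c) :
    3 ≤ Fintype.card {x // p x} :=
  Fintype.two_lt_card_iff.2 ⟨⟨a, ha⟩, ⟨b, hb⟩, ⟨c, hc⟩, by simpa, by simpa, by simpa⟩

theorem SimpleGraph.Reachable.mem_of_adj_closed {V : Type*} {G : SimpleGraph V} {S : Set V}
    (hS : ∀ a ∈ S, ∀ b, G.Adj a b → b ∈ S) {a b : V} (h : G.Reachable a b) (ha : a ∈ S) :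
    b ∈ S := by
  rw [SimpleGraph.reachable_iff_reflTransGen] at h
  induction h with
  | refl => exact ha
  | tail _ hbc ih => exact hS _ ih _ hbc

theorem graphOf_adj_inl_inr {n : ℕ} {R : Fin n → Fin n → Prop} {i j : Fin n} :
    (graphOf R).Adj (Sum.inl i) (Sum.inr j) ↔ R i j := by
  simp [graphOf]

/-- Two upper nodes whose neighbors all lie in `{a, b}` exhaust the neighbors of `a` and `b`. -/
theorem IsElementary.eq_or_eq_of_rel {n : ℕ} {R : Fin n → Fin n → Prop} (hel : IsElementary R)
    {v u a b : Fin n} (huv : u ≠ v) (hv : ∀ j, R v j → j = a ∨ j = b)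
    (hu : ∀ j, R u j → j = a ∨ j = b) {x j : Fin n} (hx : R x j) (hj : j = a ∨ j = b) :
    x = v ∨ x = u := by
  obtain ⟨σ, hσ, rfl⟩ := hel x j hx
  have hv' := hv _ (hσ v)
  have hu' := hu _ (hσ u)
  have inj := σ.injective
  by_contra! hne
  have e₁ := inj.ne hne.1
  have e₂ := inj.ne hne.2
  have e₃ := inj.ne huv
  grind

theorem IsElementary.swap {n : ℕ} {R : Fin n → Fin n → Prop} (hel : IsElementary R) :
    IsElementary (fun i j => R j i) := by
  intro i j h
  obtain ⟨σ, hσ, rfl⟩ := hel j i h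
  exact ⟨σ⁻¹, fun k => by simpa using hσ (σ⁻¹ k), by simp⟩

/-- Partner lemma: for an irreducible node `v` of degree 2 with neighbors `w₁, w₂`,
either `v`, the nodes of `N`, `w₁` and `w₂` form a connected component of `G_R`
(and then `N` is a singleton), or every `u ∈ N` has degree `≥ 3` and at least one
of `w₁, w₂` has degree `≥ 3`. -/
theorem stmt4 (n : ℕ) (R : Fin n → Fin n → Prop) [∀ i j, Decidable (R i j)]
    (hel : IsElementary R) (v w₁ w₂ : Fin n) (hw : w₁ ≠ w₂)
    (h1 : R v w₁) (h2 : R v w₂) (hdeg2 : ∀ j, R v j → j = w₁ ∨ j = w₂)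
    (hN : ({u : Fin n | u ≠ v ∧ R u w₁ ∧ R u w₂}).Nonempty) :
    (((graphOf R).connectedComponentMk (Sum.inl v)).supp
        = {Sum.inl v} ∪ (Sum.inl '' {u : Fin n | u ≠ v ∧ R u w₁ ∧ R u w₂})
            ∪ {Sum.inr w₁, Sum.inr w₂}
      ∧ ∃ u₀ : Fin n, {u : Fin n | u ≠ v ∧ R u w₁ ∧ R u w₂} = {u₀})
    ∨ ((∀ u ∈ {u : Fin n | u ≠ v ∧ R u w₁ ∧ R u w₂}, 3 ≤ upDeg R u)
        ∧ (3 ≤ loDeg R w₁ ∨ 3 ≤ loDeg R w₂)) := by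
  by_cases hdeg : ∀ u ∈ {u : Fin n | u ≠ v ∧ R u w₁ ∧ R u w₂}, 3 ≤ upDeg R u
  · refine Or.inr ⟨hdeg, ?_⟩
    obtain ⟨u, huv, hu₁, hu₂⟩ := hN
    by_contra! hlo
    have hnb : ∀ w, R v w → R u w → loDeg R w < 3 → ∀ i, R i w → i = v ∨ i = u := by
      intro w hvw huw hlt i hi
      by_contra! hne
      exact hlt.not_ge (three_le_card_subtype hi hvw huw hne.1 hne.2 huv.symm)
    have hnbu : ∀ j, R u j → j = w₁ ∨ j = w₂ := fun j hj =>
      hel.swap.eq_or_eq_of_rel hw.symm (hnb w₁ h1 hu₁ hlo.1) (hnb w₂ h2 hu₂ hlo.2) hj (Or.inr rfl)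
    obtain ⟨a, b, c, hab, hac, hbc⟩ := Fintype.two_lt_card_iff.1 (hdeg u ⟨huv, hu₁, hu₂⟩)
    have ha := hnbu a a.2
    have hb := hnbu b b.2
    have hc := hnbu c c.2
    rw [Ne, Subtype.ext_iff] at hab hac hbc
    grind
  · left
    push Not at hdeg
    obtain ⟨u, ⟨huv, hu₁, hu₂⟩, hlt⟩ := hdeg
    have hnbu : ∀ j, R u j → j = w₁ ∨ j = w₂ := by
      intro j hj
      by_contra! hne
      exact hlt.not_ge (three_le_card_subtype hj hu₁ hu₂ hne.1 hne.2 hw)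
    have hlow : ∀ i j, R i j → j = w₁ ∨ j = w₂ → i = v ∨ i = u := fun i j hij hj =>
      hel.eq_or_eq_of_rel huv hdeg2 hnbu hij hj
    have hNu : {u : Fin n | u ≠ v ∧ R u w₁ ∧ R u w₂} = {u} := by
      ext x
      refine ⟨fun hx => (hlow x w₁ hx.2.1 (Or.inl rfl)).resolve_left hx.1, ?_⟩
      rintro rfl
      exact ⟨huv, hu₁, hu₂⟩
    refine ⟨?_, u, hNu⟩
    rw [hNu]
    ext x
    rw [SimpleGraph.ConnectedComponent.mem_supp_iff, SimpleGraph.ConnectedComponent.eq]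
    constructor
    · intro hx
      refine hx.symm.mem_of_adj_closed ?_ (by simp)
      rintro (i | j) ha (k | l) hadj
      · simp [graphOf] at hadj
      · rw [graphOf_adj_inl_inr] at hadj
        have hi : i = v ∨ i = u := by simpa [or_comm] using ha
        have hl : l = w₁ ∨ l = w₂ := by
          rcases hi with rfl | rfl
          exacts [hdeg2 l hadj, hnbu l hadj]
        simpa using hl
      · have hkj := graphOf_adj_inl_inr.1 hadj.symm
        have hk := hlow k j hkj (by simpa using ha)
        simpa [or_comm] using hk
      · simp [graphOf] at hadj
    · have r₁ : (graphOf R).Reachable (Sum.inr w₁) (Sum.inl v) :=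
        (graphOf_adj_inl_inr.2 h1).symm.reachable
      have r₂ : (graphOf R).Reachable (Sum.inr w₂) (Sum.inl v) :=
        (graphOf_adj_inl_inr.2 h2).symm.reachable
      have r₃ : (graphOf R).Reachable (Sum.inl u) (Sum.inl v) :=
        (graphOf_adj_inl_inr.2 hu₁).reachable.trans r₁
      rintro ((rfl | ⟨_, rfl, rfl⟩) | rfl | rfl)
      exacts [.refl _, r₃, r₁, r₂]
end

section
/- Let R : Fin n → Fin n → Prop be elementary and irreducible with G_R connected, n ≥ 3, and m edges, and set d := m − 2n + 1 (the dimension of the corresponding face). Then the number of upper nodes of degree 2 is at most d, and if n ≠ d + 1 it is at most d − 1; the same bounds hold for the number of lower nodes of degree 2. -/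
theorem graphOf_swap_connected {n : ℕ} {R : Fin n → Fin n → Prop}
    (hconn : (graphOf R).Connected) : (graphOf (fun i j => R j i)).Connected := by
  have e : graphOf R ≃g graphOf (fun i j => R j i) :=
    { toEquiv := Equiv.sumComm _ _
      map_rel_iff' := by
        rintro (a | a) (b | b) <;> simp [graphOf, SimpleGraph.fromRel_adj] }
  exact e.connected_iff.1 hconn

theorem edgeCount_eq_sum_upDeg {n : ℕ} (R : Fin n → Fin n → Prop) [∀ i j, Decidable (R i j)] :
    edgeCount R = ∑ i, upDeg R i := by
  unfold edgeCount upDeg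
  rw [← Fintype.card_sigma]
  exact Fintype.card_congr (Equiv.subtypeProdEquivSigmaSubtype R)

theorem edgeCount_swap {n : ℕ} (R : Fin n → Fin n → Prop) [∀ i j, Decidable (R i j)] :
    edgeCount (fun i j => R j i) = edgeCount R :=
  Fintype.card_congr ((Equiv.prodComm _ _).subtypeEquiv fun _ => Iff.rfl)

/-- A nonempty set of upper nodes whose union with a set of lower nodes is closed under
adjacency in a connected graph consists of all upper nodes. -/
theorem eq_univ_of_forall_rel_mem_iff {n : ℕ} {R : Fin n → Fin n → Prop}
    (hconn : (graphOf R).Connected) {A B : Finset (Fin n)} (hA : A.Nonempty)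
    (h : ∀ i j, R i j → (i ∈ A ↔ j ∈ B)) : A = Finset.univ := by
  obtain ⟨a, ha⟩ := hA
  let P : Fin n ⊕ Fin n → Prop := Sum.elim (· ∈ A) (· ∈ B)
  have hstep : ∀ x y, (graphOf R).Adj x y → P x → P y := by
    rintro (x | x) (y | y) hxy hx
    · simp [graphOf, SimpleGraph.fromRel_adj] at hxy
    · exact (h x y (graphOf_adj_inl_inr.1 hxy)).1 hx
    · exact (h y x (graphOf_adj_inl_inr.1 hxy.symm)).2 hx
    · simp [graphOf, SimpleGraph.fromRel_adj] at hxy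
  have hwalk : ∀ x y, (graphOf R).Walk x y → P x → P y := by
    intro x y p
    induction p with
    | nil => exact id
    | cons hadj _ ih => exact fun hx => ih (hstep _ _ hadj hx)
  refine Finset.eq_univ_of_forall fun i => ?_
  obtain ⟨p⟩ := hconn.preconnected (Sum.inl a) (Sum.inl i)
  exact hwalk _ _ p ha

/-- Strict form of Hall's condition in a connected elementary graph. -/
theorem IsElementary.card_lt_card {n : ℕ} {R : Fin n → Fin n → Prop} (hel : IsElementary R)
    (hconn : (graphOf R).Connected) {A : Finset (Fin n)} (B : Finset (Fin n))
    (hA : A.Nonempty) (hA' : A ≠ Finset.univ) (hAB : ∀ i ∈ A, ∀ j, R i j → j ∈ B) :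
    A.card < B.card := by
  by_contra! hcard
  refine hA' (eq_univ_of_forall_rel_mem_iff hconn (B := B) hA fun i j hij =>
    ⟨fun hi => hAB i hi j hij, fun hj => ?_⟩)
  obtain ⟨σ, hσ, rfl⟩ := hel i j hij
  have hsub : A.map σ.toEmbedding ⊆ B := by
    intro x hx
    obtain ⟨y, hy, rfl⟩ := Finset.mem_map.1 hx
    exact hAB y hy _ (hσ y)
  rw [← Finset.eq_of_subset_of_card_le hsub (by simpa using hcard)] at hj
  simpa using hj

theorem upDeg_eq_card_filter {n : ℕ} (R : Fin n → Fin n → Prop) [∀ i j, Decidable (R i j)]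
    (i : Fin n) : upDeg R i = (Finset.univ.filter (R i)).card :=
  Fintype.card_subtype _

section

variable {n : ℕ} {R : Fin n → Fin n → Prop} [∀ i j, Decidable (R i j)]

theorem two_le_upDeg (hel : IsElementary R) (hconn : (graphOf R).Connected) (hn : 2 ≤ n)
    (i : Fin n) : 2 ≤ upDeg R i := by
  have hne : ({i} : Finset (Fin n)) ≠ Finset.univ := fun h => by
    have := congrArg Finset.card h
    simp at this
    omega
  rw [upDeg_eq_card_filter]
  simpa [Nat.lt_iff_add_one_le] using
    hel.card_lt_card hconn (Finset.univ.filter (R i)) (by simp) hne (by simp)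

/-- In an irreducible graph, the neighbors of an upper node of degree 2 are also neighbors of
some upper node of larger degree. -/
theorem exists_upDeg_ne_two_of_irreducible (hel : IsElementary R)
    (hconn : (graphOf R).Connected) (hirr : ∀ v, ¬ UpperReducible R v) (hn : 3 ≤ n)
    {v : Fin n} (hv : upDeg R v = 2) : ∃ u, upDeg R u ≠ 2 ∧ ∀ j, R v j → R u j := by
  rw [upDeg_eq_card_filter] at hv
  obtain ⟨a, b, hab, hN⟩ := Finset.card_eq_two.1 hv
  have hmem : ∀ j, R v j ↔ j = a ∨ j = b := fun j => by
    have := Finset.ext_iff.1 hN j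
    simpa using this
  have hu : ∃ u, u ≠ v ∧ R u a ∧ R u b := by
    by_contra hu
    exact hirr v ⟨a, b, hab, (hmem a).2 (.inl rfl), (hmem b).2 (.inr rfl),
      fun j => (hmem j).1, hu⟩
  obtain ⟨u, huv, hua, hub⟩ := hu
  refine ⟨u, fun hdeg => ?_, fun j hj => ?_⟩
  · rw [upDeg_eq_card_filter] at hdeg
    have hsub : ({a, b} : Finset (Fin n)) ⊆ Finset.univ.filter (R u) := by
      intro x hx
      rcases Finset.mem_insert.1 hx with rfl | hx
      · simpa using hua
      · rw [Finset.mem_singleton.1 hx]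
        simpa using hub
    have hNu := Finset.eq_of_subset_of_card_le hsub (by rw [hdeg, Finset.card_pair hab])
    have hne : ({u, v} : Finset (Fin n)) ≠ Finset.univ := fun h => by
      have := congrArg Finset.card h
      rw [Finset.card_pair huv, Finset.card_fin] at this
      omega
    have hlt := hel.card_lt_card hconn {a, b} (by simp) hne (by
      intro i hi j hij
      rcases Finset.mem_insert.1 hi with rfl | hi
      · rw [hNu]
        simpa using hij
      · rw [Finset.mem_singleton.1 hi] at hij
        simpa using (hmem j).1 hij)
    rw [Finset.card_pair huv, Finset.card_pair hab] at hlt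
    exact lt_irrefl _ hlt
  · rcases (hmem j).1 hj with rfl | rfl
    exacts [hua, hub]

/-- If the neighborhood of `u` contains that of every upper node, then `u` is adjacent to every
lower node. -/
theorem upDeg_eq_of_forall_rel_imp (hel : IsElementary R) (hconn : (graphOf R).Connected)
    (hn : 2 ≤ n) {u : Fin n} (h : ∀ i j, R i j → R u j) : upDeg R u = n := by
  have hdeg := two_le_upDeg hel hconn hn u
  obtain ⟨⟨j₀, hj₀⟩⟩ : Nonempty {j // R u j} := Fintype.card_pos_iff.1 (by
    change 0 < upDeg R u
    omega)
  obtain ⟨σ, hσ, -⟩ := hel u j₀ hj₀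
  have hall : ∀ j, R u j := fun j => h (σ.symm j) j (by simpa using hσ (σ.symm j))
  rw [upDeg_eq_card_filter, Finset.filter_true_of_mem fun j _ => hall j, Finset.card_fin]

theorem card_upDeg_eq_two_le (hel : IsElementary R) (hconn : (graphOf R).Connected)
    (hirr : ∀ v, ¬ UpperReducible R v) (hn : 3 ≤ n) {d : ℕ}
    (hd : edgeCount R + 1 = d + 2 * n) :
    Fintype.card {i : Fin n // upDeg R i = 2} ≤ d ∧
    (n ≠ d + 1 → Fintype.card {i : Fin n // upDeg R i = 2} ≤ d - 1) := by
  have hdeg := two_le_upDeg hel hconn (by omega : 2 ≤ n)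
  have hexcess : ∑ i, (upDeg R i - 2) + 2 * n = edgeCount R := by
    have hconst : ∑ _i : Fin n, 2 = 2 * n := by simp [mul_comm]
    rw [edgeCount_eq_sum_upDeg, ← hconst, ← Finset.sum_add_distrib]
    exact Finset.sum_congr rfl fun i _ => Nat.sub_add_cancel (hdeg i)
  rw [Fintype.card_subtype]
  set T : Finset (Fin n) := Finset.univ.filter fun i => upDeg R i = 2 with hT
  let C : Fin n → Finset (Fin n) := fun u => T.filter fun v => ∀ j, R v j → R u j
  by_cases hfull : ∃ u, upDeg R u ≠ 2 ∧ insert u (C u) = Finset.univ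
  · obtain ⟨u, hu, huniv⟩ := hfull
    have hmem : ∀ i, i ≠ u → i ∈ C u := fun i hi => by
      have : i ∈ insert u (C u) := huniv ▸ Finset.mem_univ i
      exact (Finset.mem_insert.1 this).resolve_left hi
    have hun : upDeg R u = n := by
      refine upDeg_eq_of_forall_rel_imp hel hconn (by omega) fun i j hij => ?_
      by_cases hi : i = u
      · exact hi ▸ hij
      · exact (Finset.mem_filter.1 (hmem i hi)).2 j hij
    have hsum : ∑ i, (upDeg R i - 2) = upDeg R u - 2 := by
      refine Finset.sum_eq_single u (fun i _ hi => ?_) (by simp)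
      have := (Finset.mem_filter.1 (Finset.mem_filter.1 (hmem i hi)).1).2
      omega
    have hcard : T.card < n := by
      conv_rhs => rw [← Finset.card_fin n]
      refine Finset.card_lt_card (Finset.ssubset_univ_iff.2 fun h => hu ?_)
      have : u ∈ T := h ▸ Finset.mem_univ u
      exact (Finset.mem_filter.1 this).2
    omega
  · push Not at hfull
    have hC : ∀ u, upDeg R u ≠ 2 → (C u).card ≤ upDeg R u - 2 := fun u hu => by
      have hlt := hel.card_lt_card hconn (Finset.univ.filter (R u))
        (Finset.insert_nonempty _ _) (hfull u hu) (by
          intro i hi j hij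
          rcases Finset.mem_insert.1 hi with rfl | hi
          · simpa using hij
          · simpa using (Finset.mem_filter.1 hi).2 j hij)
      have huC : u ∉ C u := fun h =>
        hu (Finset.mem_filter.1 (Finset.mem_filter.1 h).1).2
      rw [Finset.card_insert_of_notMem huC, ← upDeg_eq_card_filter] at hlt
      omega
    have hcover : T ⊆ (Finset.univ.filter fun u => upDeg R u ≠ 2).biUnion C := by
      intro v hv
      obtain ⟨u, hu, huv⟩ := exists_upDeg_ne_two_of_irreducible hel hconn hirr hn
        (Finset.mem_filter.1 hv).2
      exact Finset.mem_biUnion.2 ⟨u, by simpa using hu, Finset.mem_filter.2 ⟨hv, huv⟩⟩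
    have hle : T.card ≤ ∑ i, (upDeg R i - 2) :=
      calc T.card ≤ _ := Finset.card_le_card hcover
        _ ≤ _ := Finset.card_biUnion_le
        _ ≤ ∑ u ∈ Finset.univ.filter (fun u => upDeg R u ≠ 2), (upDeg R u - 2) :=
          Finset.sum_le_sum fun u hu => hC u (Finset.mem_filter.1 hu).2
        _ ≤ _ := Finset.sum_le_sum_of_subset (Finset.filter_subset _ _)
    omega

end

/-- A connected irreducible face graph of dimension `d` with `n ≥ 3` nodes has at
most `d` nodes of degree 2 in each layer, and at most `d - 1` if `n ≠ d + 1`.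
The dimension `d = m - 2n + 1` is encoded by `m + 1 = d + 2n`. -/
theorem stmt6 (n : ℕ) (R : Fin n → Fin n → Prop) [∀ i j, Decidable (R i j)]
    (hel : IsElementary R) (hirr : IrreducibleRel R) (hconn : (graphOf R).Connected)
    (hn : 3 ≤ n) (d : ℕ) (hd : edgeCount R + 1 = d + 2 * n) :
    Fintype.card {i : Fin n // upDeg R i = 2} ≤ d ∧
    Fintype.card {j : Fin n // loDeg R j = 2} ≤ d ∧
    (n ≠ d + 1 →
      Fintype.card {i : Fin n // upDeg R i = 2} ≤ d - 1 ∧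
      Fintype.card {j : Fin n // loDeg R j = 2} ≤ d - 1) := by
  obtain ⟨hup, hup'⟩ := card_upDeg_eq_two_le hel hconn hirr.1 hn hd
  obtain ⟨hlo, hlo'⟩ := card_upDeg_eq_two_le hel.swap (graphOf_swap_connected hconn) hirr.2 hn
    ((congrArg (· + 1) (edgeCount_swap R)).trans hd)
  exact ⟨hup, hlo, fun h => ⟨hup' h, hlo' h⟩⟩
end

section
/- Let R : Fin n → Fin n → Prop be elementary and irreducible with G_R connected and m edges, and suppose m ≥ 2n + 2, i.e. the dimension d := m − 2n + 1 satisfies d ≥ 3. Then n ≤ 2d − 2: a connected irreducible face graph of a d-dimensional face (d ≥ 3) has at most 2d − 2 nodes in each layer. -/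
open Finset

/-- In a connected elementary graph, a nonempty set of upper nodes with at most as many
neighbors as elements consists of all upper nodes. -/
theorem eq_univ_of_card_neighbors_le {n : ℕ} {R : Fin n → Fin n → Prop}
    (hel : IsElementary R) (hconn : (graphOf R).Connected) {X N : Finset (Fin n)}
    (hX : X.Nonempty) (hN : ∀ i ∈ X, ∀ j, R i j → j ∈ N) (hcard : #N ≤ #X) :
    X = univ := by
  have back : ∀ i j, R i j → j ∈ N → i ∈ X := by
    intro i j hij hj
    obtain ⟨σ, hσ, rfl⟩ := hel i j hij
    have himage : X.map σ.toEmbedding = N := by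
      refine eq_of_subset_of_card_le (fun k hk => ?_) (by simpa using hcard)
      obtain ⟨l, hl, rfl⟩ := mem_map.1 hk
      exact hN l hl _ (hσ l)
    rw [← himage] at hj
    simpa using hj
  have step : ∀ a b : Fin n ⊕ Fin n, (graphOf R).Adj a b →
      Sum.elim (· ∈ X) (· ∈ N) a → Sum.elim (· ∈ X) (· ∈ N) b := by
    intro a b hab ha
    rw [graphOf, SimpleGraph.fromRel_adj] at hab
    obtain ⟨-, ⟨i, j, rfl, rfl, h⟩ | ⟨i, j, rfl, rfl, h⟩⟩ := hab
    · exact hN i ha j h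
    · exact back i j h ha
  have walk : ∀ a b : Fin n ⊕ Fin n, (graphOf R).Walk a b →
      Sum.elim (· ∈ X) (· ∈ N) a → Sum.elim (· ∈ X) (· ∈ N) b := by
    intro a b w
    induction w with
    | nil => exact id
    | cons h _ ih => exact fun ha => ih (step _ _ h ha)
  obtain ⟨x, hx⟩ := hX
  refine eq_univ_of_forall fun y => ?_
  obtain ⟨w⟩ := hconn.preconnected (Sum.inl x) (Sum.inl y)
  exact walk _ _ w hx

/-- In a graph with a matching, a set of upper nodes has at least as many neighbors
as elements. -/
theorem IsMatching.card_le {n : ℕ} {R : Fin n → Fin n → Prop} {σ : Equiv.Perm (Fin n)}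
    (hσ : IsMatching R σ) {X N : Finset (Fin n)} (hN : ∀ i ∈ X, ∀ j, R i j → j ∈ N) :
    #X ≤ #N := by
  rw [← card_map σ.toEmbedding]
  refine card_le_card fun k hk => ?_
  obtain ⟨l, hl, rfl⟩ := mem_map.1 hk
  exact hN l hl _ (hσ l)

theorem edgeCount_eq_sum {n : ℕ} (R : Fin n → Fin n → Prop) [∀ i j, Decidable (R i j)] :
    edgeCount R = ∑ i, #{j | R i j} := by
  rw [edgeCount, Fintype.card_subtype, card_filter, Fintype.sum_prod_type]
  simp only [card_filter]

/-- A connected irreducible `d`-dimensional face graph with `d ≥ 3` has at most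
`2d - 2` nodes in each layer. The hypothesis `m ≥ 2n + 2` says `d = m - 2n + 1 ≥ 3`,
and `d` is encoded by `m + 1 = d + 2n`. -/
theorem stmt7 (n : ℕ) (R : Fin n → Fin n → Prop) [∀ i j, Decidable (R i j)]
    (hel : IsElementary R) (hirr : IrreducibleRel R) (hconn : (graphOf R).Connected)
    (hm : 2 * n + 2 ≤ edgeCount R)
    (d : ℕ) (hd : edgeCount R + 1 = d + 2 * n) :
    n ≤ 2 * d - 2 := by
  set N : Fin n → Finset (Fin n) := fun i => {j | R i j} with hNdef
  have memN : ∀ i j, j ∈ N i ↔ R i j := by simp [hNdef]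
  have hsum : edgeCount R = ∑ i, #(N i) := edgeCount_eq_sum R
  obtain ⟨⟨⟨i₀, j₀⟩, h₀⟩⟩ : Nonempty {p : Fin n × Fin n // R p.1 p.2} :=
    Fintype.card_pos_iff.1 (show 0 < edgeCount R by omega)
  obtain ⟨τ, hτ, -⟩ := hel i₀ j₀ h₀
  -- no nonempty proper set of upper nodes is tight, and the whole set has many edges
  have tight : ∀ X : Finset (Fin n), X.Nonempty → ∀ M : Finset (Fin n),
      (∀ i ∈ X, N i ⊆ M) → #M ≤ #X → 2 * #X + 2 ≤ ∑ i ∈ X, #(N i) := by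
    intro X hX M hM hcard
    have huniv := eq_univ_of_card_neighbors_le hel hconn hX
      (fun i hi j hj => hM i hi ((memN i j).2 hj)) hcard
    subst huniv
    rw [← hsum]
    simpa using hm
  have two_le : ∀ i, 2 ≤ #(N i) := by
    intro i
    by_contra! hlt
    have := tight {i} (by simp) (N i) (by simp) (by simp; omega)
    simp at this
    omega
  set A : Finset (Fin n) := {i | #(N i) = 2} with hA
  set B : Finset (Fin n) := {i | ¬ #(N i) = 2} with hB
  have partner : ∀ v ∈ A, ∃ u ∈ B, N v ⊆ N u := by
    intro v hv
    have hv2 : #(N v) = 2 := by simpa [hA] using hv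
    obtain ⟨w₁, w₂, hne, hw⟩ := card_eq_two.1 hv2
    have hred := hirr.1 v
    obtain ⟨u, huv, h₁, h₂⟩ : ∃ u, u ≠ v ∧ R u w₁ ∧ R u w₂ := by
      by_contra hu
      exact hred ⟨w₁, w₂, hne, by simp [← memN, hw], by simp [← memN, hw],
        fun j hj => by simpa [← memN, hw] using hj, hu⟩
    have hsub : N v ⊆ N u := by
      rw [hw]
      intro j hj
      rw [mem_insert, mem_singleton] at hj
      rcases hj with rfl | rfl
      · exact (memN _ _).2 h₁
      · exact (memN _ _).2 h₂
    refine ⟨u, ?_, hsub⟩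
    simp only [hB, mem_filter, mem_univ, true_and]
    intro hu2
    have := tight {u, v} (by simp) (N u) (by simp [hsub]) (by rw [card_pair huv, hu2])
    rw [card_pair huv, sum_pair huv] at this
    omega
  set S : Fin n → Finset (Fin n) := fun u => {v ∈ A | N v ⊆ N u} with hS
  have hSB : ∀ u ∈ B, #(S u) + 5 ≤ 2 * #(N u) := by
    intro u hu
    have hu2 : ¬ #(N u) = 2 := by simpa [hB] using hu
    have hu3 := two_le u
    have hnot : u ∉ S u := by simp [hS, hA, hu2]
    have hsub : ∀ i ∈ insert u (S u), N i ⊆ N u := by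
      intro i hi
      rcases mem_insert.1 hi with rfl | hi
      · exact Subset.rfl
      · exact (mem_filter.1 hi).2
    have hle : #(insert u (S u)) ≤ #(N u) :=
      hτ.card_le fun i hi j hj => hsub i hi ((memN i j).2 hj)
    have hSsum : ∑ v ∈ S u, #(N v) = #(S u) * 2 :=
      sum_const_nat fun v hv => by simpa [hA] using (mem_filter.1 hv).1
    have ht := tight (insert u (S u)) (by simp) (N u) hsub
    rw [card_insert_of_notMem hnot] at hle ht
    rw [sum_insert hnot, hSsum] at ht
    by_cases h : #(N u) ≤ #(S u) + 1
    · have := ht h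
      omega
    · omega
  have hAcard : #A ≤ ∑ u ∈ B, #(S u) := by
    refine (card_le_card fun v hv => ?_).trans card_biUnion_le
    obtain ⟨u, hu, hvu⟩ := partner v hv
    exact mem_biUnion.2 ⟨u, hu, mem_filter.2 ⟨hv, hvu⟩⟩
  have hBsum := sum_le_sum hSB
  rw [sum_add_distrib, ← mul_sum, sum_const, smul_eq_mul] at hBsum
  have hAsum : ∑ v ∈ A, #(N v) = #A * 2 :=
    sum_const_nat fun v hv => by simpa [hA] using hv
  have hsplit : ∑ v ∈ A, #(N v) + ∑ v ∈ B, #(N v) = ∑ v, #(N v) :=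
    sum_filter_add_sum_filter_not _ _ _
  have hn : #A + #B = n := by
    simpa using card_filter_add_card_filter_not (s := (univ : Finset (Fin n)))
      (fun i => #(N i) = 2)
  omega
end

section
/- Let R : Fin n → Fin n → Prop be elementary and irreducible with G_R connected, n ≥ 4, and m edges. Then m ≥ 2n + ⌈n/2⌉ (where ⌈n/2⌉ = (n+1)/2 with natural division). -/
/-- The lower nodes adjacent to a nonempty proper set `S` of upper nodes outnumber `S`
in a connected elementary graph. -/
theorem IsElementary.card_lt_card_neighbors {n : ℕ} {R : Fin n → Fin n → Prop}
    [∀ i j, Decidable (R i j)] (hel : IsElementary R) (hconn : (graphOf R).Connected)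
    {S : Finset (Fin n)} {a b : Fin n} (ha : a ∈ S) (hb : b ∉ S) :
    S.card < (Finset.univ.filter fun j => ∃ i ∈ S, R i j).card := by
  by_contra! hle
  set N := Finset.univ.filter fun j => ∃ i ∈ S, R i j with hN
  have hclosed : ∀ i j, R i j → (i ∈ S ↔ j ∈ N) := by
    intro i j hij
    refine ⟨fun hi => by simpa [hN] using ⟨i, hi, hij⟩, fun hj => ?_⟩
    obtain ⟨σ, hσ, rfl⟩ := hel i j hij
    have hsub : S.map σ.toEmbedding ⊆ N := by
      intro k hk
      obtain ⟨l, hl, rfl⟩ := Finset.mem_map.1 hk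
      simpa [hN] using ⟨l, hl, hσ l⟩
    have heq := Finset.eq_of_subset_of_card_le hsub (by simpa using hle)
    rw [← heq] at hj
    simpa using hj
  let P : Fin n ⊕ Fin n → Prop := Sum.elim (· ∈ S) (· ∈ N)
  have hadj : ∀ x y, (graphOf R).Adj x y → P x → P y := by
    rintro x y hxy hx
    obtain ⟨-, ⟨i, j, rfl, rfl, hij⟩ | ⟨i, j, rfl, rfl, hij⟩⟩ :=
      (SimpleGraph.fromRel_adj _ _ _).1 hxy
    · exact (hclosed i j hij).1 hx
    · exact (hclosed i j hij).2 hx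
  have hwalk : ∀ x y, (graphOf R).Walk x y → P x → P y := by
    intro x y w
    induction w with
    | nil => exact id
    | cons h _ ih => exact fun hx => ih (hadj _ _ h hx)
  obtain ⟨w⟩ := hconn.preconnected (Sum.inl a) (Sum.inl b)
  exact hb (hwalk _ _ w ha)

/-- A connected irreducible face graph with `n ≥ 4` nodes in each layer has at least
`2n + ⌈n/2⌉` edges. -/
theorem stmt9 (n : ℕ) (R : Fin n → Fin n → Prop) [∀ i j, Decidable (R i j)]
    (hel : IsElementary R) (hirr : IrreducibleRel R) (hconn : (graphOf R).Connected)
    (hn : 4 ≤ n) :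
    2 * n + (n + 1) / 2 ≤ edgeCount R := by
  classical
  let N : Fin n → Finset (Fin n) := fun i => Finset.univ.filter (R i)
  have hdeg : ∀ i, upDeg R i = (N i).card := fun i => Fintype.card_subtype _
  have hmem : ∀ i j, j ∈ N i ↔ R i j := by simp [N]
  -- Strict Hall condition in terms of any superset of the neighborhood.
  have hall : ∀ (S M : Finset (Fin n)), S.Nonempty → S.card < n →
      (∀ i ∈ S, N i ⊆ M) → S.card + 1 ≤ M.card := by
    intro S M ⟨a, ha⟩ hS hM
    obtain ⟨b, hb⟩ : ∃ b, b ∉ S := by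
      by_contra! h
      rw [Finset.eq_univ_iff_forall.2 h, Finset.card_fin] at hS
      exact hS.false
    refine (hel.card_lt_card_neighbors hconn ha hb).trans_le (Finset.card_le_card ?_)
    intro j hj
    obtain ⟨i, hi, hij⟩ := (Finset.mem_filter.1 hj).2
    exact hM i hi ((hmem i j).2 hij)
  have htwo : ∀ i, 2 ≤ (N i).card := fun i => by
    simpa using hall {i} (N i) (by simp) (by simp; omega) (by simp)
  let T : Fin n → Finset (Fin n) := fun u =>
    Finset.univ.filter fun v => (N v).card = 2 ∧ v ≠ u ∧ N v ⊆ N u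
  have huT : ∀ u, u ∉ T u := by simp [T]
  have hTsub : ∀ u, ∀ v ∈ T u, N v ⊆ N u := fun u v hv => (Finset.mem_filter.1 hv).2.2.2
  let A : Finset (Fin n) := Finset.univ.filter fun i => ¬ 3 ≤ (N i).card
  let B : Finset (Fin n) := Finset.univ.filter fun i => 3 ≤ (N i).card
  have hcover : A ⊆ B.biUnion T := by
    intro v hv
    have hv2 : (N v).card = 2 := by
      have := (Finset.mem_filter.1 hv).2
      have := htwo v
      omega
    obtain ⟨w₁, w₂, hw, hNv⟩ := Finset.card_eq_two.1 hv2
    have hRv : ∀ j, R v j ↔ j = w₁ ∨ j = w₂ := by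
      intro j
      rw [← hmem, hNv]
      simp
    obtain ⟨u, huv, hu₁, hu₂⟩ : ∃ u, u ≠ v ∧ R u w₁ ∧ R u w₂ := by
      by_contra h
      exact hirr.1 v ⟨w₁, w₂, hw, (hRv _).2 (.inl rfl), (hRv _).2 (.inr rfl),
        fun j => (hRv j).1, h⟩
    have hsub : N v ⊆ N u := by
      intro j hj
      rw [hmem] at hj ⊢
      rcases (hRv j).1 hj with rfl | rfl <;> assumption
    have hcard := hall {u, v} (N u) (by simp) (by rw [Finset.card_pair huv]; omega)
      (by simp [hsub])
    rw [Finset.card_pair huv] at hcard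
    exact Finset.mem_biUnion.2 ⟨u, by simpa [B] using hcard, by simp [T, hv2, huv.symm, hsub]⟩
  rw [edgeCount_eq_sum_upDeg, Finset.sum_congr rfl fun i _ => hdeg i]
  by_cases hex : ∃ u, (insert u (T u)).card = n
  · obtain ⟨u, hu⟩ := hex
    have hu' := Finset.card_insert_of_notMem (huT u)
    have hdu := hall (T u) (N u) (Finset.card_pos.1 (by omega)) (by omega) (hTsub u)
    have hrest : ∑ i ∈ Finset.univ.erase u, 2 ≤ ∑ i ∈ Finset.univ.erase u, (N i).card :=
      Finset.sum_le_sum fun i _ => htwo i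
    have hsum := Finset.add_sum_erase Finset.univ (fun i => (N i).card) (Finset.mem_univ u)
    simp only [Finset.sum_const, Finset.card_erase_of_mem (Finset.mem_univ u), Finset.card_fin,
      smul_eq_mul] at hrest hsum
    omega
  · push Not at hex
    have hT : ∀ u, (T u).card + 2 ≤ (N u).card := by
      intro u
      have hlt : (insert u (T u)).card < n :=
        lt_of_le_of_ne ((Finset.card_le_univ _).trans_eq (Fintype.card_fin n)) (hex u)
      have := hall (insert u (T u)) (N u) (by simp) hlt (by simpa using hTsub u)
      rwa [Finset.card_insert_of_notMem (huT u)] at this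
    have hA : A.card ≤ ∑ u ∈ B, (T u).card :=
      (Finset.card_le_card hcover).trans Finset.card_biUnion_le
    have hAB : B.card + A.card = n :=
      (Finset.card_filter_add_card_filter_not _).trans (Finset.card_fin n)
    have hsum : ∑ i ∈ B, (N i).card + ∑ i ∈ A, (N i).card = ∑ i, (N i).card :=
      Finset.sum_filter_add_sum_filter_not _ _ _
    have hA₂ : ∑ i ∈ A, 2 ≤ ∑ i ∈ A, (N i).card := Finset.sum_le_sum fun i _ => htwo i
    have hB₃ : ∑ i ∈ B, 3 ≤ ∑ i ∈ B, (N i).card :=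
      Finset.sum_le_sum fun i hi => (Finset.mem_filter.1 hi).2
    have hBT : ∑ u ∈ B, ((T u).card + 2) ≤ ∑ u ∈ B, (N u).card :=
      Finset.sum_le_sum fun u _ => hT u
    simp only [Finset.sum_add_distrib, Finset.sum_const, smul_eq_mul] at hA₂ hB₃ hBT
    omega
end

section
/- Let R : Fin n → Fin n → Prop be elementary with G_R connected, and let a, b satisfy R a b. Suppose there is exactly one matching σ of R with σ a = b. Then for every matching τ of R with τ ≠ σ, the closed segment between the corresponding permutation matrices is a face of face(R): IsExtreme ℝ (face R) (segment ℝ (M σ) (M τ)). In words, the vertex M(σ) is joined by an edge of the polytope face(R) to every other vertex. -/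
/-- A matching contained in the union of `σ` and `τ` has a complementary matching in that union. -/
lemma exists_complementary_perm {n : ℕ} (σ τ ρ : Equiv.Perm (Fin n))
    (h : ∀ i, ρ i = σ i ∨ ρ i = τ i) :
    ∃ ρ' : Equiv.Perm (Fin n), ∀ i, ρ' i = if ρ i = σ i then τ i else σ i := by
  have hcross : ∀ i j, ρ i ≠ σ i → ρ j = σ j → σ i = τ j → False := by
    intro i j hi hj hij
    obtain ⟨l, hl⟩ := ρ.surjective (σ i)
    rcases h l with hl' | hl'
    · have : l = i := σ.injective (hl'.symm.trans hl)
      exact hi (this ▸ hl)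
    · have hlj : l = j := τ.injective (hl'.symm.trans (hl.trans hij))
      subst hlj
      have : l = i := σ.injective (hj.symm.trans hl)
      exact hi (this ▸ hj)
  have hinj : Function.Injective fun i => if ρ i = σ i then τ i else σ i := by
    intro i j hij
    dsimp only at hij
    split_ifs at hij with hi hj hj
    · exact τ.injective hij
    · exact (hcross j i hj hi hij.symm).elim
    · exact (hcross i j hi hj hij).elim
    · exact σ.injective hij
  exact ⟨Equiv.ofBijective _ (Finite.injective_iff_bijective.mp hinj), fun _ => rfl⟩

/-- If `σ` is the only matching through `(a, σ a)`, the union of `σ` and `τ` contains no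
matchings besides `σ` and `τ`. -/
lemma eq_or_eq_of_forall_eq_or_eq {n : ℕ} {R : Fin n → Fin n → Prop} {a : Fin n}
    {σ τ ρ : Equiv.Perm (Fin n)} (hσ : IsMatching R σ) (hτ : IsMatching R τ)
    (huniq : ∀ ρ : Equiv.Perm (Fin n), IsMatching R ρ → ρ a = σ a → ρ = σ)
    (h : ∀ i, ρ i = σ i ∨ ρ i = τ i) : ρ = σ ∨ ρ = τ := by
  by_cases ha : ρ a = σ a
  · refine Or.inl (huniq ρ (fun i => ?_) ha)
    rcases h i with hi | hi <;> rw [hi]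
    exacts [hσ i, hτ i]
  · obtain ⟨ρ', hρ'⟩ := exists_complementary_perm σ τ ρ h
    have hm : IsMatching R ρ' := by
      intro i
      rw [hρ' i]
      split_ifs
      exacts [hτ i, hσ i]
    have he := huniq ρ' hm (by rw [hρ' a, if_neg ha])
    refine Or.inr (Equiv.ext fun i => ?_)
    have hi := hρ' i
    rw [he] at hi
    split_ifs at hi with hc
    · rw [hc, hi]
    · exact (h i).resolve_left hc

lemma permMat_nonneg {n : ℕ} (σ : Equiv.Perm (Fin n)) (i j : Fin n) : 0 ≤ permMat σ i j := by
  unfold permMat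
  split_ifs <;> norm_num

lemma nonneg_of_mem_face {n : ℕ} {R : Fin n → Fin n → Prop} {x : Matrix (Fin n) (Fin n) ℝ}
    (hx : x ∈ face R) (i j : Fin n) : 0 ≤ x i j := by
  have hc : Convex ℝ {x : Matrix (Fin n) (Fin n) ℝ | 0 ≤ x i j} := by
    intro x hx y hy s t hs ht _
    simp only [Set.mem_ofPred_eq, Matrix.add_apply, Matrix.smul_apply, smul_eq_mul] at *
    positivity
  refine convexHull_min ?_ hc hx
  rintro _ ⟨ρ, -, rfl⟩
  exact permMat_nonneg ρ i j

/-- If the union of `σ` and `τ` contains no further matchings of `R`, the points of `face R`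
supported on this union form the segment between the two permutation matrices. -/
lemma mem_segment_of_mem_face {n : ℕ} {R : Fin n → Fin n → Prop} {σ τ : Equiv.Perm (Fin n)}
    (h : ∀ ρ : Equiv.Perm (Fin n), IsMatching R ρ → (∀ i, ρ i = σ i ∨ ρ i = τ i) →
      ρ = σ ∨ ρ = τ)
    {x : Matrix (Fin n) (Fin n) ℝ} (hx : x ∈ face R)
    (hsupp : ∀ i j, σ i ≠ j → τ i ≠ j → x i j = 0) :
    x ∈ segment ℝ (permMat σ) (permMat τ) := by
  let T : Set (Matrix (Fin n) (Fin n) ℝ) := {x | x ∈ face R ∧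
    ((∀ i j, σ i ≠ j → τ i ≠ j → x i j = 0) → x ∈ segment ℝ (permMat σ) (permMat τ))}
  have hT : Convex ℝ T := by
    rw [convex_iff_forall_pos]
    rintro x ⟨hx, hxs⟩ y ⟨hy, hys⟩ s t hs ht hst
    refine ⟨convex_convexHull ℝ _ hx hy hs.le ht.le hst, fun hz => ?_⟩
    have hzero : ∀ i j, σ i ≠ j → τ i ≠ j → x i j = 0 ∧ y i j = 0 := by
      intro i j h1 h2
      have hxy := hz i j h1 h2
      simp only [Matrix.add_apply, Matrix.smul_apply, smul_eq_mul] at hxy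
      have hx0 := nonneg_of_mem_face hx i j
      have hy0 := nonneg_of_mem_face hy i j
      rw [add_eq_zero_iff_of_nonneg (by positivity) (by positivity)] at hxy
      exact ⟨(mul_eq_zero.mp hxy.1).resolve_left hs.ne', (mul_eq_zero.mp hxy.2).resolve_left ht.ne'⟩
    exact convex_segment _ _ (hxs fun i j h1 h2 => (hzero i j h1 h2).1)
      (hys fun i j h1 h2 => (hzero i j h1 h2).2) hs.le ht.le hst
  have hsub : face R ⊆ T := by
    refine convexHull_min ?_ hT
    rintro _ ⟨ρ, hρ, rfl⟩
    refine ⟨subset_convexHull ℝ _ ⟨ρ, hρ, rfl⟩, fun hs => ?_⟩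
    have hρ' : ∀ i, ρ i = σ i ∨ ρ i = τ i := by
      intro i
      by_contra! hne
      have h0 := hs i (ρ i) hne.1.symm hne.2.symm
      simp [permMat] at h0
    rcases h ρ hρ hρ' with rfl | rfl
    · exact left_mem_segment ℝ _ _
    · exact right_mem_segment ℝ _ _
  exact (hsub hx).2 hsupp

/-- If an edge `(a, b)` of `R` lies in exactly one matching `σ`, then `M(σ)` is
joined by an edge of `face R` to every other vertex: for every matching `τ ≠ σ`,
the segment from `M(σ)` to `M(τ)` is a face of `face R`. -/
theorem stmt11 (n : ℕ) (R : Fin n → Fin n → Prop)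
    (hel : IsElementary R) (hconn : (graphOf R).Connected)
    (a b : Fin n) (hab : R a b)
    (σ : Equiv.Perm (Fin n)) (hσ : IsMatching R σ) (hσab : σ a = b)
    (huniq : ∀ τ : Equiv.Perm (Fin n), IsMatching R τ → τ a = b → τ = σ) :
    ∀ τ : Equiv.Perm (Fin n), IsMatching R τ → τ ≠ σ →
      IsExtreme ℝ (face R) (segment ℝ (permMat σ) (permMat τ)) := by
  intro τ hτ _
  subst hσab
  refine ⟨(convex_convexHull ℝ _).segment_subset (subset_convexHull ℝ _ ⟨σ, hσ, rfl⟩)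
    (subset_convexHull ℝ _ ⟨τ, hτ, rfl⟩), ?_⟩
  rintro x hx y hy z ⟨p, q, -, -, -, rfl⟩ ⟨s, t, hs, ht, -, hz⟩
  refine mem_segment_of_mem_face
    (fun ρ _ hρ => eq_or_eq_of_forall_eq_or_eq hσ hτ huniq hρ) hx fun i j h1 h2 => ?_
  have hij := congrFun (congrFun hz i) j
  simp only [Matrix.add_apply, Matrix.smul_apply, smul_eq_mul, permMat, if_neg h1, if_neg h2,
    mul_zero, add_zero] at hij
  have hx0 := nonneg_of_mem_face hx i j
  have hy0 := nonneg_of_mem_face hy i j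
  rw [add_eq_zero_iff_of_nonneg (by positivity) (by positivity)] at hij
  exact (mul_eq_zero.mp hij.1).resolve_left hs.ne'
end

section
/- Let R : Fin n → Fin n → Prop be elementary and irreducible with G_R connected. Then face(R) is a pyramid if and only if some edge of R is contained in a unique matching; precisely: (∃ a b, R a b ∧ there is exactly one matching σ of R with σ a = b) ↔ (∃ a matching σ of R such that M(σ) ∉ affineSpan ℝ {M(τ) | τ a matching of R, τ ≠ σ}). -/
/-- A vertex whose edge `(a, b)` lies in no other matching is affinely independent of the
other vertices, because their `(a, b)` entries all vanish. -/
theorem permMat_notMem_affineSpan {n : ℕ} {R : Fin n → Fin n → Prop}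
    {σ : Equiv.Perm (Fin n)} {a : Fin n}
    (huniq : ∀ τ : Equiv.Perm (Fin n), IsMatching R τ → τ a = σ a → τ = σ) :
    permMat σ ∉ affineSpan ℝ
      {M : Matrix (Fin n) (Fin n) ℝ |
        ∃ τ : Equiv.Perm (Fin n), IsMatching R τ ∧ τ ≠ σ ∧ M = permMat τ} := by
  intro hmem
  have hle : affineSpan ℝ {M : Matrix (Fin n) (Fin n) ℝ |
      ∃ τ : Equiv.Perm (Fin n), IsMatching R τ ∧ τ ≠ σ ∧ M = permMat τ} ≤
      (LinearMap.ker (Matrix.entryLinearMap ℝ ℝ a (σ a))).toAffineSubspace := by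
    rw [affineSpan_le]
    rintro _ ⟨τ, hτ, hne, rfl⟩
    have : τ a ≠ σ a := fun h => hne (huniq τ hτ h)
    simp [permMat, this]
  simpa [permMat] using hle hmem

/-- If every edge of `σ` lies in some other matching, then subtracting `permMat σ` from the sum
of such matchings leaves a nonnegative matrix supported on `R`, a combination of matchings of `R`
by Birkhoff's theorem. -/
theorem permMat_mem_affineSpan {n : ℕ} {R : Fin n → Fin n → Prop} (hn : 0 < n)
    {σ : Equiv.Perm (Fin n)} (t : Fin n → Equiv.Perm (Fin n))
    (ht : ∀ i, IsMatching R (t i)) (hne : ∀ i, t i ≠ σ) (hti : ∀ i, t i i = σ i) :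
    permMat σ ∈ affineSpan ℝ
      {M : Matrix (Fin n) (Fin n) ℝ |
        ∃ τ : Equiv.Perm (Fin n), IsMatching R τ ∧ τ ≠ σ ∧ M = permMat τ} := by
  classical
  set S : Set (Matrix (Fin n) (Fin n) ℝ) :=
    {M | ∃ τ : Equiv.Perm (Fin n), IsMatching R τ ∧ τ ≠ σ ∧ M = permMat τ}
  let i₀ : Fin n := ⟨0, hn⟩
  have hn2 : (0 : ℝ) < n - 1 := by
    have : 1 < n := by
      by_contra h
      obtain rfl : n = 1 := by omega
      exact hne i₀ (Subsingleton.elim _ _)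
    have : (1 : ℝ) < n := by exact_mod_cast this
    linarith
  set A : Matrix (Fin n) (Fin n) ℝ := ∑ i, permMat (t i) - permMat σ with hA
  have hentry : ∀ i j, A i j = ∑ k, permMat (t k) i j - permMat σ i j := by
    intro i j
    simp [hA, Matrix.sum_apply]
  have hpos : ∀ (τ : Equiv.Perm (Fin n)) i j, 0 ≤ permMat τ i j := by
    intro τ i j
    unfold permMat
    split_ifs <;> norm_num
  have hrow : ∀ (τ : Equiv.Perm (Fin n)) i, ∑ j, permMat τ i j = 1 := by
    intro τ i
    simp [permMat]
  have hcol : ∀ (τ : Equiv.Perm (Fin n)) j, ∑ i, permMat τ i j = 1 := by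
    intro τ j
    simp [permMat, ← Equiv.eq_symm_apply]
  have hAnonneg : ∀ i j, 0 ≤ A i j := by
    intro i j
    rw [hentry, sub_nonneg]
    refine le_trans ?_ (Finset.single_le_sum (fun k _ => hpos (t k) i j) (Finset.mem_univ i))
    simp [permMat, hti]
  have hAsupp : ∀ i j, A i j ≠ 0 → R i j := by
    intro i j
    contrapose!
    intro hR
    have hzero : ∀ τ : Equiv.Perm (Fin n), IsMatching R τ → permMat τ i j = 0 := by
      intro τ hτ
      have : τ i ≠ j := by
        rintro rfl
        exact hR (hτ i)
      simp [permMat, this]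
    refine le_antisymm ?_ (hAnonneg i j)
    rw [hentry, Finset.sum_eq_zero fun k _ => hzero (t k) (ht k)]
    linarith [hpos σ i j]
  have hB : ((n : ℝ) - 1)⁻¹ • A ∈ doublyStochastic ℝ (Fin n) := by
    rw [mem_doublyStochastic_iff_sum]
    refine ⟨fun i j => ?_, fun i => ?_, fun j => ?_⟩
    · exact mul_nonneg (inv_nonneg.2 hn2.le) (hAnonneg i j)
    · have : ∑ j, A i j = n - 1 := by
        simp only [hentry, Finset.sum_sub_distrib]
        rw [Finset.sum_comm]
        simp [hrow]
      simp only [Matrix.smul_apply, smul_eq_mul]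
      rw [← Finset.mul_sum, this, inv_mul_cancel₀ hn2.ne']
    · have : ∑ i, A i j = n - 1 := by
        simp only [hentry, Finset.sum_sub_distrib]
        rw [Finset.sum_comm]
        simp [hcol]
      simp only [Matrix.smul_apply, smul_eq_mul]
      rw [← Finset.mul_sum, this, inv_mul_cancel₀ hn2.ne']
  obtain ⟨c, hc0, hc1, hcB⟩ := exists_eq_sum_perm_of_mem_doublyStochastic hB
  simp only [← permMat_eq_permMatrix] at hcB
  have hcA : A = ((n : ℝ) - 1) • ∑ τ, c τ • permMat τ := by
    rw [hcB, smul_inv_smul₀ hn2.ne']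
  have hcR : ∀ τ, c τ ≠ 0 → IsMatching R τ := by
    intro τ hτ i
    apply hAsupp
    rw [hcA]
    have h1 : c τ ≤ ∑ ρ, c ρ * permMat ρ i (τ i) := by
      refine le_trans ?_ (Finset.single_le_sum
        (fun ρ _ => mul_nonneg (hc0 ρ) (hpos ρ i (τ i))) (Finset.mem_univ τ))
      simp [permMat]
    have h2 : 0 < c τ := lt_of_le_of_ne (hc0 τ) hτ.symm
    simp only [Matrix.smul_apply, Matrix.sum_apply, smul_eq_mul]
    exact (mul_pos hn2 (h2.trans_le h1)).ne'
  have hmem : ∀ τ, IsMatching R τ → τ ≠ σ → permMat τ ∈ affineSpan ℝ S :=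
    fun τ h1 h2 => subset_affineSpan ℝ S ⟨τ, h1, h2, rfl⟩
  set p := permMat (t i₀)
  have hpS : p ∈ affineSpan ℝ S := hmem _ (ht i₀) (hne i₀)
  have hdir : ∀ τ, IsMatching R τ → τ ≠ σ →
      permMat τ - p ∈ (affineSpan ℝ S).direction :=
    fun τ h1 h2 => AffineSubspace.vsub_mem_direction (hmem τ h1 h2) hpS
  have hsum : ∑ τ, c τ • (permMat τ - p) = (∑ τ, c τ • permMat τ) - p := by
    simp only [smul_sub, Finset.sum_sub_distrib, ← Finset.sum_smul, hc1, one_smul]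
  have hsplit : (1 + ((n : ℝ) - 1) * c σ) • (permMat σ - p) =
      ∑ i, (permMat (t i) - p) -
        ((n : ℝ) - 1) • ∑ τ ∈ Finset.univ.erase σ, c τ • (permMat τ - p) := by
    have h1 := Finset.add_sum_erase Finset.univ (fun τ => c τ • (permMat τ - p))
      (Finset.mem_univ σ)
    have h2 : ∑ τ ∈ Finset.univ.erase σ, c τ • (permMat τ - p) =
        (∑ τ, c τ • permMat τ) - p - c σ • (permMat σ - p) := by
      rw [← hsum, ← h1]
      simp
    have h3 : ∑ i, (permMat (t i) - p) = A + permMat σ - (n : ℝ) • p := by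
      simp [hA, Finset.sum_sub_distrib, Nat.cast_smul_eq_nsmul]
    rw [h2, h3, hcA]
    module
  have hscaled : (1 + ((n : ℝ) - 1) * c σ) • (permMat σ - p) ∈
      (affineSpan ℝ S).direction := by
    rw [hsplit]
    refine Submodule.sub_mem _ (Submodule.sum_mem _ fun i _ => hdir _ (ht i) (hne i))
      (Submodule.smul_mem _ _ (Submodule.sum_mem _ fun τ hτ => ?_))
    by_cases h : c τ = 0
    · simp [h]
    · exact Submodule.smul_mem _ _ (hdir τ (hcR τ h) (Finset.ne_of_mem_erase hτ))
  have hcoef : (1 + ((n : ℝ) - 1) * c σ) ≠ 0 := by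
    have := mul_nonneg hn2.le (hc0 σ)
    positivity
  exact (AffineSubspace.vsub_right_mem_direction_iff_mem hpS _).1
    ((Submodule.smul_mem_iff _ hcoef).1 hscaled)

/-- A connected irreducible face graph defines a pyramid if and only if some edge is
contained in a unique matching. Being a pyramid means: some vertex (the apex) does
not lie in the affine span of the remaining vertices. -/
theorem stmt12 (n : ℕ) (R : Fin n → Fin n → Prop)
    (hel : IsElementary R) (hirr : IrreducibleRel R) (hconn : (graphOf R).Connected) :
    (∃ a b : Fin n, R a b ∧ ∃! σ : Equiv.Perm (Fin n), IsMatching R σ ∧ σ a = b) ↔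
    (∃ σ : Equiv.Perm (Fin n), IsMatching R σ ∧
      permMat σ ∉ affineSpan ℝ
        {M : Matrix (Fin n) (Fin n) ℝ |
          ∃ τ : Equiv.Perm (Fin n), IsMatching R τ ∧ τ ≠ σ ∧ M = permMat τ}) := by
  constructor
  · rintro ⟨a, b, -, σ, ⟨hσ, rfl⟩, huniq⟩
    exact ⟨σ, hσ, permMat_notMem_affineSpan fun τ hτ h => huniq τ ⟨hτ, h⟩⟩
  · rintro ⟨σ, hσ, hnot⟩
    by_contra! hcon
    have hn : 0 < n := by
      obtain ⟨i | i⟩ := hconn.nonempty <;> exact i.pos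
    have hex : ∀ i, ∃ τ : Equiv.Perm (Fin n), IsMatching R τ ∧ τ ≠ σ ∧ τ i = σ i := by
      intro i
      by_contra! h
      refine hcon i (σ i) (hσ i) ⟨σ, ⟨hσ, rfl⟩, ?_⟩
      rintro τ ⟨hτ, hi⟩
      by_contra hτσ
      exact h τ hτ hτσ hi
    choose t ht hne hti using hex
    exact hnot (permMat_mem_affineSpan hn t ht hne hti)
end

section
/- Let R : Fin n → Fin n → Prop be elementary and irreducible with G_R connected, and let u, v : Fin n satisfy ¬R u v. Suppose there is exactly one permutation σ₀ of Fin n with σ₀ u = v and R i (σ₀ i) for all i ≠ u (i.e. the graph of R with nodes u and v deleted has a unique perfect matching). Define R' i j := R i j ∨ (i = u ∧ j = v). Then: (1) R' is elementary; (2) σ₀ is the unique matching of R' with σ₀ u = v; (3) M(σ₀) ∉ affineSpan ℝ (face R); and (4) face(R') = convexHull ℝ (face(R) ∪ {M(σ₀)}). Hence face(R') is a pyramid with base face(R) and apex M(σ₀). -/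
theorem permMat_apply_self {n : ℕ} (σ : Equiv.Perm (Fin n)) (i : Fin n) :
    permMat σ i (σ i) = 1 := by
  simp [permMat]

/-- Points of the affine span of `face R` vanish at every non-edge of `R`. -/
theorem apply_eq_zero_of_mem_affineSpan_face {n : ℕ} {R : Fin n → Fin n → Prop} {i j : Fin n}
    (hij : ¬ R i j) {M : Matrix (Fin n) (Fin n) ℝ} (hM : M ∈ affineSpan ℝ (face R)) :
    M i j = 0 := by
  let V : Submodule ℝ (Matrix (Fin n) (Fin n) ℝ) :=
    LinearMap.ker (Matrix.entryLinearMap ℝ ℝ i j)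
  have hV : affineSpan ℝ (face R) ≤ V.toAffineSubspace := by
    rw [face, affineSpan_convexHull, affineSpan_le]
    rintro _ ⟨σ, hσ, rfl⟩
    have hne : σ i ≠ j := fun h => hij (h ▸ hσ i)
    simp [V, permMat, hne]
  simpa [V] using hV hM

/-- If `σ₀` is the only matching of `R'` that is not a matching of `R`, then `face R'` is
the convex hull of `face R` and `permMat σ₀`. -/
theorem face_eq_convexHull_face_union {n : ℕ} {R R' : Fin n → Fin n → Prop}
    {σ₀ : Equiv.Perm (Fin n)} (h : ∀ τ, IsMatching R' τ ↔ IsMatching R τ ∨ τ = σ₀) :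
    face R' = convexHull ℝ (face R ∪ {permMat σ₀}) := by
  rw [face, face, convexHull_convexHull_union_left]
  congr 1
  ext M
  simp only [h, Set.mem_ofPred_eq, Set.mem_union, Set.mem_singleton_iff, or_and_right, exists_or,
    exists_eq_left]

/-- Adding an edge `(u, v)` to a connected irreducible face graph whose graph with
`u` and `v` deleted has a unique perfect matching yields a face graph whose face is
the pyramid over `face R` with apex `M(σ₀)`. -/
theorem stmt13 (n : ℕ) (R : Fin n → Fin n → Prop)
    (hel : IsElementary R) (hirr : IrreducibleRel R) (hconn : (graphOf R).Connected)
    (u v : Fin n) (huv : ¬ R u v)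
    (σ₀ : Equiv.Perm (Fin n)) (hσ₀u : σ₀ u = v) (hσ₀ : ∀ i, i ≠ u → R i (σ₀ i))
    (huniq : ∀ τ : Equiv.Perm (Fin n), τ u = v → (∀ i, i ≠ u → R i (τ i)) → τ = σ₀) :
    IsElementary (fun i j => R i j ∨ (i = u ∧ j = v)) ∧
    (IsMatching (fun i j => R i j ∨ (i = u ∧ j = v)) σ₀ ∧
      ∀ τ : Equiv.Perm (Fin n),
        IsMatching (fun i j => R i j ∨ (i = u ∧ j = v)) τ → τ u = v → τ = σ₀) ∧
    permMat σ₀ ∉ affineSpan ℝ (face R) ∧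
    face (fun i j => R i j ∨ (i = u ∧ j = v)) = convexHull ℝ (face R ∪ {permMat σ₀}) := by
  have hm : IsMatching (fun i j => R i j ∨ (i = u ∧ j = v)) σ₀ := fun i =>
    (eq_or_ne i u).elim (fun h => Or.inr ⟨h, h ▸ hσ₀u⟩) fun h => Or.inl (hσ₀ i h)
  have hu : ∀ τ : Equiv.Perm (Fin n),
      IsMatching (fun i j => R i j ∨ (i = u ∧ j = v)) τ → τ u = v → τ = σ₀ := fun τ hτ hτu =>
    huniq τ hτu fun i hi => (hτ i).resolve_right fun h => hi h.1
  refine ⟨?_, ⟨hm, hu⟩, ?_, face_eq_convexHull_face_union fun τ => ⟨fun hτ => ?_, ?_⟩⟩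
  · rintro i j (hij | ⟨rfl, rfl⟩)
    · obtain ⟨σ, hσ, hσi⟩ := hel i j hij
      exact ⟨σ, fun k => Or.inl (hσ k), hσi⟩
    · exact ⟨σ₀, hm, hσ₀u⟩
  · intro h
    have h₀ := apply_eq_zero_of_mem_affineSpan_face huv h
    have h₁ := permMat_apply_self σ₀ u
    rw [hσ₀u, h₀] at h₁
    exact zero_ne_one h₁
  · by_cases hτu : τ u = v
    · exact Or.inr (hu τ hτ hτu)
    · exact Or.inl fun i => (hτ i).resolve_right fun h => hτu (h.1 ▸ h.2)
  · rintro (hτ | rfl)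
    · exact fun i => Or.inl (hτ i)
    · exact hm
end

section
/- Let R : Fin n → Fin n → Prop be elementary and irreducible, let v be an upper node of degree 2 with distinct neighbors w₁, w₂, and let x ≠ v be an upper node with R x w₁ and ¬R x w₂. Define R' by replacing the edge (x, w₁) with (x, w₂): R' i j := (R i j ∧ ¬(i = x ∧ j = w₁)) ∨ (i = x ∧ j = w₂). Then R' is elementary and the faces face(R) and face(R') are combinatorially isomorphic: there is an order isomorphism, with respect to set inclusion, between the face poset of face(R) and the face poset of face(R'). -/
/-- A linear equivalence maps faces of `P` to faces of the image of `P`. -/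
theorem image_mem_facesOf {E F : Type*} [AddCommGroup E] [Module ℝ E] [AddCommGroup F]
    [Module ℝ F] (T : E ≃ₗ[ℝ] F) {P t : Set E} (ht : t ∈ facesOf P) :
    T '' t ∈ facesOf (T '' P) := by
  obtain ⟨hconv, hsub, hext⟩ := ht
  refine ⟨hconv.linear_image T.toLinearMap, Set.image_mono hsub, ?_⟩
  rintro _ ⟨a, ha, rfl⟩ _ ⟨b, hb, rfl⟩ _ ⟨c, hc, rfl⟩ hseg
  refine Set.mem_image_of_mem T (hext ha hb hc ?_)
  have himage : T c ∈ T '' openSegment ℝ a b := by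
    exact (image_openSegment ℝ T.toLinearMap.toAffineMap a b).symm ▸ hseg
  exact (T.injective.mem_set_image).mp himage

/-- Linearly equivalent sets have isomorphic face posets. -/
def facesOfOrderIso {E F : Type*} [AddCommGroup E] [Module ℝ E] [AddCommGroup F]
    [Module ℝ F] (T : E ≃ₗ[ℝ] F) {P : Set E} {Q : Set F} (h : T '' P = Q) :
    ↥(facesOf P) ≃o ↥(facesOf Q) where
  toFun t := ⟨T '' t.1, h ▸ image_mem_facesOf T t.2⟩
  invFun t := ⟨T.symm '' t.1, by
    have hP : T.symm '' Q = P := by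
      rw [← h]
      exact T.toEquiv.symm_image_image P
    exact hP ▸ image_mem_facesOf T.symm t.2⟩
  left_inv t := Subtype.ext (T.symm_image_image t.1)
  right_inv t := Subtype.ext (T.image_symm_image t.1)
  map_rel_iff' := Set.image_subset_image_iff T.injective

/-- The linear automorphism exchanging the coordinates `(x, w₁)` and `(x, w₂)` and compensating
in row `v`, so that the column sums of the matrix are preserved on `{M | M x w₂ = 0}`. -/
def edgeShift {n : ℕ} {v w₁ w₂ x : Fin n} (hw : w₁ ≠ w₂) (hxv : x ≠ v) :
    Matrix (Fin n) (Fin n) ℝ ≃ₗ[ℝ] Matrix (Fin n) (Fin n) ℝ where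
  toFun M := Matrix.of fun i j =>
    if i = x then M x (Equiv.swap w₁ w₂ j)
    else if i = v then
      if j = w₁ then M v w₁ + M x w₁ else if j = w₂ then M v w₂ - M x w₁ else M v j
    else M i j
  invFun M := Matrix.of fun i j =>
    if i = x then M x (Equiv.swap w₁ w₂ j)
    else if i = v then
      if j = w₁ then M v w₁ - M x w₂ else if j = w₂ then M v w₂ + M x w₂ else M v j
    else M i j
  map_add' M N := by
    ext i j
    simp only [Matrix.add_apply, Matrix.of_apply]
    split_ifs <;> ring
  map_smul' c M := by
    ext i j
    simp only [Matrix.smul_apply, Matrix.of_apply, smul_eq_mul, RingHom.id_apply]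
    split_ifs <;> ring
  left_inv M := by
    ext i j
    by_cases hi : i = x
    · simp [hi]
    · by_cases hv : i = v <;> by_cases hj : j = w₁ <;> by_cases hk : j = w₂ <;>
        simp_all [hxv.symm, hw.symm]
  right_inv M := by
    ext i j
    by_cases hi : i = x
    · simp [hi]
    · by_cases hv : i = v <;> by_cases hj : j = w₁ <;> by_cases hk : j = w₂ <;>
        simp_all [hxv.symm, hw.symm]

section

variable {n : ℕ} {v w₁ w₂ x : Fin n}

theorem edgeShift_permMat_of_ne (hw : w₁ ≠ w₂) (hxv : x ≠ v) {σ : Equiv.Perm (Fin n)}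
    (hσ₁ : σ x ≠ w₁) (hσ₂ : σ x ≠ w₂) :
    edgeShift hw hxv (permMat σ) = permMat σ := by
  ext i j
  simp only [edgeShift, LinearEquiv.coe_mk, LinearMap.coe_mk, AddHom.coe_mk, Matrix.of_apply,
    permMat, Equiv.swap_apply_def]
  grind

theorem edgeShift_permMat_of_eq (hw : w₁ ≠ w₂) (hxv : x ≠ v) {σ : Equiv.Perm (Fin n)}
    (hσ₁ : σ x = w₁) (hσ₂ : σ v = w₂) :
    edgeShift hw hxv (permMat σ) = permMat (σ.trans (Equiv.swap w₁ w₂)) := by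
  have hne : ∀ i, i ≠ x → σ i ≠ w₁ := fun i hi h => hi (σ.injective (h.trans hσ₁.symm))
  have hne' : ∀ i, i ≠ v → σ i ≠ w₂ := fun i hi h => hi (σ.injective (h.trans hσ₂.symm))
  ext i j
  simp only [edgeShift, LinearEquiv.coe_mk, LinearMap.coe_mk, AddHom.coe_mk, Matrix.of_apply,
    permMat, Equiv.swap_apply_def, Equiv.trans_apply]
  grind

/-- The relation obtained from `R` by replacing the edge `(x, w₁)` with `(x, w₂)`. -/
abbrev replaceEdge (R : Fin n → Fin n → Prop) (x w₁ w₂ : Fin n) : Fin n → Fin n → Prop :=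
  fun i j => (R i j ∧ ¬(i = x ∧ j = w₁)) ∨ (i = x ∧ j = w₂)

variable {R : Fin n → Fin n → Prop} {σ : Equiv.Perm (Fin n)}

theorem IsMatching.replaceEdge_of_ne (hσ : IsMatching R σ) (hne : σ x ≠ w₁) :
    IsMatching (replaceEdge R x w₁ w₂) σ :=
  fun i => Or.inl ⟨hσ i, by rintro ⟨rfl, h⟩; exact hne h⟩

theorem IsMatching.replaceEdge_of_eq (hσ : IsMatching R σ) (hxv : x ≠ v) (h1 : R v w₁)
    (hx : σ x = w₁) (hv : σ v = w₂) :
    IsMatching (replaceEdge R x w₁ w₂) (σ.trans (Equiv.swap w₁ w₂)) := by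
  intro i
  have hi := hσ i
  have hne : i ≠ x → σ i ≠ w₁ := fun hi h => hi (σ.injective (h.trans hx.symm))
  have hne' : i ≠ v → σ i ≠ w₂ := fun hi h => hi (σ.injective (h.trans hv.symm))
  simp only [Equiv.trans_apply, Equiv.swap_apply_def]
  grind

theorem IsMatching.of_replaceEdge_of_ne (hσ : IsMatching (replaceEdge R x w₁ w₂) σ)
    (hne : σ x ≠ w₂) : IsMatching R σ ∧ σ x ≠ w₁ := by
  refine ⟨fun i => ?_, fun h => ?_⟩
  · rcases hσ i with h | ⟨rfl, h⟩
    exacts [h.1, absurd h hne]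
  · rcases hσ x with h' | h'
    exacts [h'.2 ⟨rfl, h⟩, hne h'.2]

theorem IsMatching.apply_eq_of_degree_two (hσ : IsMatching R σ)
    (hdeg2 : ∀ j, R v j → j = w₁ ∨ j = w₂) (hxv : x ≠ v) (hx : σ x = w₁) : σ v = w₂ :=
  (hdeg2 _ (hσ v)).resolve_left fun h => hxv (σ.injective (hx.trans h.symm))

theorem IsMatching.of_replaceEdge_of_eq (hσ : IsMatching (replaceEdge R x w₁ w₂) σ)
    (hxv : x ≠ v) (h2 : R v w₂) (hxw1 : R x w₁)
    (hdeg2 : ∀ j, R v j → j = w₁ ∨ j = w₂) (hx : σ x = w₂) :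
    IsMatching R (σ.trans (Equiv.swap w₁ w₂)) := by
  have hv : σ v = w₁ := by
    refine hσ.apply_eq_of_degree_two (fun j hj => ?_) hxv hx
    rcases hj with h | h
    exacts [(hdeg2 j h.1).symm, absurd h.1.symm hxv]
  intro i
  have hi := hσ i
  have hne : i ≠ x → σ i ≠ w₂ := fun hi h => hi (σ.injective (h.trans hx.symm))
  have hne' : i ≠ v → σ i ≠ w₁ := fun hi h => hi (σ.injective (h.trans hv.symm))
  simp only [Equiv.trans_apply, Equiv.swap_apply_def]
  grind

/-- The coordinate change `edgeShift` maps `face R` onto the face of the modified relation. -/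
theorem edgeShift_image_face (hw : w₁ ≠ w₂) (hxv : x ≠ v) (h1 : R v w₁) (h2 : R v w₂)
    (hdeg2 : ∀ j, R v j → j = w₁ ∨ j = w₂) (hxw1 : R x w₁) (hxw2 : ¬ R x w₂) :
    edgeShift hw hxv '' face R = face (replaceEdge R x w₁ w₂) := by
  have hne {σ : Equiv.Perm (Fin n)} (hσ : IsMatching R σ) : σ x ≠ w₂ :=
    fun h => hxw2 (h ▸ hσ x)
  refine ((edgeShift hw hxv).toLinearMap.image_convexHull _).trans
    (congrArg (convexHull ℝ) (Set.Subset.antisymm ?_ ?_))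
  · rintro _ ⟨_, ⟨σ, hσ, rfl⟩, rfl⟩
    by_cases hx : σ x = w₁
    · have hv := hσ.apply_eq_of_degree_two hdeg2 hxv hx
      exact ⟨_, hσ.replaceEdge_of_eq hxv h1 hx hv, edgeShift_permMat_of_eq hw hxv hx hv⟩
    · exact ⟨σ, hσ.replaceEdge_of_ne hx, edgeShift_permMat_of_ne hw hxv hx (hne hσ)⟩
  · rintro _ ⟨σ, hσ, rfl⟩
    by_cases hx : σ x = w₂
    · have hτ := hσ.of_replaceEdge_of_eq hxv h2 hxw1 hdeg2 hx
      have hτx : σ.trans (Equiv.swap w₁ w₂) x = w₁ := by simp [hx]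
      refine ⟨_, ⟨_, hτ, rfl⟩, (edgeShift_permMat_of_eq hw hxv hτx
        (hτ.apply_eq_of_degree_two hdeg2 hxv hτx)).trans (congrArg permMat ?_)⟩
      ext i
      simp
    · obtain ⟨hσR, hx'⟩ := hσ.of_replaceEdge_of_ne hx
      exact ⟨_, ⟨σ, hσR, rfl⟩, edgeShift_permMat_of_ne hw hxv hx' hx⟩

theorem IsElementary.replaceEdge (hel : IsElementary R) (hred : ¬ UpperReducible R v)
    (hw : w₁ ≠ w₂) (hxv : x ≠ v) (h1 : R v w₁) (h2 : R v w₂)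
    (hdeg2 : ∀ j, R v j → j = w₁ ∨ j = w₂) (hxw1 : R x w₁) (hxw2 : ¬ R x w₂) :
    IsElementary (replaceEdge R x w₁ w₂) := by
  rintro i j (⟨hij, hne⟩ | ⟨rfl, rfl⟩)
  · obtain ⟨σ, hσ, rfl⟩ := hel i j hij
    by_cases hx : σ x = w₁
    · have hv := hσ.apply_eq_of_degree_two hdeg2 hxv hx
      have hix : i ≠ x := by
        rintro rfl
        exact hne ⟨rfl, hx⟩
      by_cases hiv : i = v
      · obtain ⟨u, huv, hu1, hu2⟩ : ∃ u, u ≠ v ∧ R u w₁ ∧ R u w₂ := by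
          by_contra h
          exact hred ⟨w₁, w₂, hw, h1, h2, hdeg2, h⟩
        obtain ⟨τ, hτ, hτu⟩ := hel u w₁ hu1
        refine ⟨τ, hτ.replaceEdge_of_ne fun h => hxw2 ?_, ?_⟩
        · rwa [τ.injective (h.trans hτu.symm)]
        · rw [hiv, hv, hτ.apply_eq_of_degree_two hdeg2 huv hτu]
      · refine ⟨_, hσ.replaceEdge_of_eq hxv h1 hx hv, Equiv.swap_apply_of_ne_of_ne ?_ ?_⟩
        · exact fun h => hix (σ.injective (h.trans hx.symm))
        · exact fun h => hiv (σ.injective (h.trans hv.symm))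
    · exact ⟨σ, hσ.replaceEdge_of_ne hx, rfl⟩
  · obtain ⟨σ, hσ, hx⟩ := hel _ w₁ hxw1
    have hv := hσ.apply_eq_of_degree_two hdeg2 hxv hx
    exact ⟨_, hσ.replaceEdge_of_eq hxv h1 hx hv, by simp [hx]⟩

end

/-- Reduction lemma: if `v` is an upper node of degree 2 with distinct neighbors
`w₁, w₂` and `x ≠ v` is adjacent to `w₁` but not `w₂`, then replacing the edge
`(x, w₁)` by `(x, w₂)` yields an elementary relation whose face is combinatorially
isomorphic to `face R`. -/
theorem stmt14 (n : ℕ) (R : Fin n → Fin n → Prop)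
    (hel : IsElementary R) (hirr : IrreducibleRel R)
    (v w₁ w₂ x : Fin n) (hw : w₁ ≠ w₂)
    (h1 : R v w₁) (h2 : R v w₂) (hdeg2 : ∀ j, R v j → j = w₁ ∨ j = w₂)
    (hxv : x ≠ v) (hxw1 : R x w₁) (hxw2 : ¬ R x w₂) :
    IsElementary (fun i j => (R i j ∧ ¬(i = x ∧ j = w₁)) ∨ (i = x ∧ j = w₂)) ∧
    Nonempty (↥(facesOf (face R)) ≃o
      ↥(facesOf (face (fun i j => (R i j ∧ ¬(i = x ∧ j = w₁)) ∨ (i = x ∧ j = w₂))))) :=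
  ⟨hel.replaceEdge (hirr.1 v) hw hxv h1 h2 hdeg2 hxw1 hxw2,
    ⟨facesOfOrderIso (edgeShift hw hxv)
      (edgeShift_image_face hw hxv h1 h2 hdeg2 hxw1 hxw2)⟩⟩
end
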